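/- There exist a constant k_0 ∈ ℕ and a function ε: ℕ → (0,∞) with ε_k → 0 as k → ∞ such that for every k ≥ k_0 and every d with 2k·ln k − ln k − 4 ≤ d ≤ 2k·ln k, the following holds w.h.p. for G = G(n,⌈dn/2⌉): every k-coloring σ of G satisfies (1) |σ̂^{-1}(0)| ≤ n·k^{−2/3}; (2) | |σ̂^{-1}(i)| − n/k | ≤ ε_k·n/k for all i ∈ {1,...,k}; and (3) the number of indices i ∈ {1,...,k} with | |σ̂^{-1}(i)| − n/k | > n/(k·(ln k)^3) is at most (ln k)^9. -/

import Mathlib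

open Filter

/-- Uniform counting probability on a finite sample space `Ω`. -/
noncomputable def prob {Ω : Type*} (p : Ω → Prop) : ℝ :=
  (Nat.card {x : Ω // p x} : ℝ) / (Nat.card Ω : ℝ)

/-- The sample space of the random graph `G(n,m)`. -/
def GraphSpace (n m : ℕ) : Type :=
  {E : Finset (Sym2 (Fin n)) // E.card = m ∧ ∀ e ∈ E, ¬ e.IsDiag}

/-- `σ` is a proper `k`-coloring of the graph with edge set `E`. -/
def IsColoring {n k : ℕ} (E : Finset (Sym2 (Fin n))) (σ : Fin n → Fin k) : Prop :=
  ∀ u v : Fin n, s(u, v) ∈ E → σ u ≠ σ v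

/-- `S` is a set such that every `v ∈ S` has, for each color `j ≠ σ v`, at least two
neighbors `u ∈ S` with `σ u = j`. -/
def StableSet {n k : ℕ} (E : Finset (Sym2 (Fin n))) (σ : Fin n → Fin k)
    (S : Set (Fin n)) : Prop :=
  ∀ v ∈ S, ∀ j : Fin k, j ≠ σ v →
    ∃ u₁ u₂ : Fin n, u₁ ∈ S ∧ u₂ ∈ S ∧ u₁ ≠ u₂ ∧
      s(v, u₁) ∈ E ∧ s(v, u₂) ∈ E ∧ σ u₁ = j ∧ σ u₂ = j

/-- `S(σ)`: the largest `StableSet` (the union of all of them). The whitening `σ̂`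
of `σ` equals `σ` on `whiteSet E σ` and `0` outside of it. -/
def whiteSet {n k : ℕ} (E : Finset (Sym2 (Fin n))) (σ : Fin n → Fin k) : Set (Fin n) :=
  {v | ∃ S : Set (Fin n), StableSet E σ S ∧ v ∈ S}

section
open scoped Classical
open Finset

theorem choose_mul_pow_le_choose_mul_pow {Q N : ℕ} (h : Q ≤ N) (m : ℕ) :
    Q.choose m * N ^ m ≤ N.choose m * Q ^ m := by
  induction m with
  | zero => simp
  | succ m ih =>
    have key : (Q - m) * N ≤ Q * (N - m) := by
      rcases le_total Q m with hm | hm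
      · simp [Nat.sub_eq_zero_of_le hm]
      · obtain ⟨a, rfl⟩ := Nat.exists_eq_add_of_le hm
        obtain ⟨b, rfl⟩ := Nat.exists_eq_add_of_le h
        have : m + a + b - m = a + b := by omega
        rw [this]
        simp only [Nat.add_sub_cancel_left]
        nlinarith [Nat.zero_le (m * b)]
    have h1 := Nat.choose_succ_right_eq Q m
    have h2 := Nat.choose_succ_right_eq N m
    refine Nat.le_of_mul_le_mul_right ?_ (Nat.succ_pos m)
    calc Q.choose (m + 1) * N ^ (m + 1) * (m + 1)
        = Q.choose (m + 1) * (m + 1) * N ^ (m + 1) := by ring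
      _ = (Q.choose m * N ^ m) * ((Q - m) * N) := by rw [h1]; ring
      _ ≤ (N.choose m * Q ^ m) * (Q * (N - m)) := Nat.mul_le_mul ih key
      _ = N.choose m * (N - m) * Q ^ (m + 1) := by ring
      _ = N.choose (m + 1) * Q ^ (m + 1) * (m + 1) := by rw [← h2]; ring

/-- The mode of the binomial distribution with parameters `Q` and `m / Q` is `m`. -/
theorem choose_mul_pow_mul_pow_le_mode {Q m : ℕ} (hm : m ≤ Q) (j : ℕ) (hj : j ≤ Q) :
    Q.choose j * m ^ j * (Q - m) ^ (Q - j) ≤ Q.choose m * m ^ m * (Q - m) ^ (Q - m) := by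
  have step : ∀ i, i < Q →
      (Q.choose (i + 1) * m ^ (i + 1) * (Q - m) ^ (Q - (i + 1))) * ((i + 1) * (Q - m)) =
        (Q.choose i * m ^ i * (Q - m) ^ (Q - i)) * ((Q - i) * m) := by
    intro i hi
    have h1 := Nat.choose_succ_right_eq Q i
    have h2 : Q - i = (Q - (i + 1)) + 1 := by omega
    calc _ = Q.choose (i + 1) * (i + 1) * m ^ (i + 1) * (Q - m) ^ ((Q - (i + 1)) + 1) := by ring
      _ = _ := by rw [h1, ← h2]; ring
  rcases eq_or_lt_of_le hm with rfl | hmQ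
  · rcases eq_or_lt_of_le hj with rfl | hjm
    · exact le_rfl
    · have : m - j ≠ 0 := by omega
      simp [this]
  have hQm : 0 < Q - m := by omega
  rcases le_total j m with hjm | hjm
  · refine Nat.decreasingInduction' (P := fun i => Q.choose i * m ^ i * (Q - m) ^ (Q - i) ≤
      Q.choose m * m ^ m * (Q - m) ^ (Q - m)) ?_ hjm le_rfl
    intro i hi _ ih
    refine le_trans ?_ ih
    have hs := step i (by omega)
    have hle : (i + 1) * (Q - m) ≤ (Q - i) * m := by
      obtain ⟨a, rfl⟩ := Nat.exists_eq_add_of_lt hi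
      obtain ⟨b, rfl⟩ := Nat.exists_eq_add_of_lt hmQ
      have e1 : i + a + 1 + b + 1 - (i + a + 1) = b + 1 := by omega
      have e2 : i + a + 1 + b + 1 - i = a + b + 2 := by omega
      rw [e1, e2]
      nlinarith [Nat.zero_le (a * b), Nat.zero_le (a * a), Nat.zero_le (i * a)]
    have hpos : 0 < (i + 1) * (Q - m) := by positivity
    refine Nat.le_of_mul_le_mul_right ?_ hpos
    rw [hs]
    exact Nat.mul_le_mul_left _ hle
  · induction j, hjm using Nat.le_induction with
    | base => exact le_rfl
    | succ i hi ih =>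
      refine le_trans ?_ (ih (by omega))
      have hs := step i (by omega)
      have hle : (Q - i) * m ≤ (i + 1) * (Q - m) :=
        (Nat.mul_le_mul (by omega : Q - i ≤ Q - m) (by omega : m ≤ i + 1)).trans_eq (by ring)
      have hpos : 0 < (i + 1) * (Q - m) := by positivity
      refine Nat.le_of_mul_le_mul_right ?_ hpos
      rw [hs]
      exact Nat.mul_le_mul_left _ hle

theorem one_le_succ_mul_binomial_mode {Q m : ℕ} (hm : m ≤ Q) (hQ : 0 < Q) :
    (1 : ℝ) ≤ (Q + 1) *
      (Q.choose m * ((m / Q : ℝ) ^ m * (1 - m / Q : ℝ) ^ (Q - m))) := by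
  have hQ' : (0 : ℝ) < Q := by exact_mod_cast hQ
  have h1 : (1 - m / Q : ℝ) = ((Q - m : ℕ) : ℝ) / Q := by
    rw [Nat.cast_sub hm]; field_simp
  have hterm : ∀ j ∈ range (Q + 1),
      (m / Q : ℝ) ^ j * (1 - m / Q : ℝ) ^ (Q - j) * (Q.choose j : ℝ) ≤
        Q.choose m * ((m / Q : ℝ) ^ m * (1 - m / Q : ℝ) ^ (Q - m)) := by
    intro j hj
    have hj' : j ≤ Q := by simpa [Nat.lt_succ_iff] using hj
    have := choose_mul_pow_mul_pow_le_mode hm j hj'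
    have h2 : ∀ i, i ≤ Q → (m / Q : ℝ) ^ i * (1 - m / Q : ℝ) ^ (Q - i) * (Q.choose i : ℝ) =
        ((Q.choose i * m ^ i * (Q - m) ^ (Q - i) : ℕ) : ℝ) / (Q : ℝ) ^ Q := by
      intro i hi
      rw [h1, div_pow, div_pow]
      have : (Q : ℝ) ^ Q = (Q : ℝ) ^ i * (Q : ℝ) ^ (Q - i) := by
        rw [← pow_add]; congr 1; omega
      rw [this]; push_cast
      field_simp
    rw [h2 j hj', mul_comm (Q.choose m : ℝ), h2 m hm]
    gcongr
  have hsum : ∑ j ∈ range (Q + 1),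
      (m / Q : ℝ) ^ j * (1 - m / Q : ℝ) ^ (Q - j) * (Q.choose j : ℝ) = 1 := by
    rw [← add_pow]; simp
  calc (1 : ℝ) = _ := hsum.symm
    _ ≤ _ := sum_le_card_nsmul _ _ _ hterm
    _ = _ := by simp

/-- The expectation of `h E` when `E` is a random subset of `B` that contains every element of `B`
independently with probability `p`. -/
noncomputable def binomExp {α : Type*} (p : ℝ) (B : Finset α) (h : Finset α → ℝ) : ℝ :=
  ∑ E ∈ B.powerset, p ^ #E * (1 - p) ^ (#B - #E) * h E

variable {α : Type*}

theorem binomExp_mono {p : ℝ} (hp0 : 0 ≤ p) (hp1 : p ≤ 1) {B : Finset α} {h g : Finset α → ℝ}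
    (hhg : ∀ E ⊆ B, h E ≤ g E) : binomExp p B h ≤ binomExp p B g := by
  refine sum_le_sum fun E hE => ?_
  have : 0 ≤ 1 - p := by linarith
  exact mul_le_mul_of_nonneg_left (hhg E (mem_powerset.1 hE)) (by positivity)

theorem binomExp_sum {p : ℝ} {B : Finset α} {ι : Type*} (s : Finset ι)
    (h : ι → Finset α → ℝ) :
    binomExp p B (fun E => ∑ i ∈ s, h i E) = ∑ i ∈ s, binomExp p B (h i) := by
  simp only [binomExp, mul_sum]
  rw [sum_comm]

theorem binomExp_const_mul {p : ℝ} {B : Finset α} (c : ℝ) (h : Finset α → ℝ) :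
    binomExp p B (fun E => c * h E) = c * binomExp p B h := by
  simp only [binomExp, mul_sum]
  exact sum_congr rfl fun _ _ => by ring

variable [DecidableEq α]

theorem binomExp_pow_card_inter {p : ℝ} {B P : Finset α} (hP : P ⊆ B) (c : ℝ) :
    binomExp p B (fun E => c ^ #(E ∩ P)) = (1 - p + p * c) ^ #P := by
  have h := prod_add (fun e => if e ∈ P then p * c else p) (fun _ => 1 - p) B
  have h2 : ∏ e ∈ B, ((if e ∈ P then p * c else p) + (1 - p)) = (1 - p + p * c) ^ #P := by
    have : ∀ e ∈ B, ((if e ∈ P then p * c else p) + (1 - p)) =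
        if e ∈ P then (1 - p + p * c) else 1 := by
      intro e _; split_ifs <;> ring
    rw [prod_congr rfl this, prod_ite]
    simp [filter_mem_eq_inter, inter_eq_right.2 hP]
  rw [← h2, h]
  refine sum_congr rfl fun E hE => ?_
  rw [mem_powerset] at hE
  rw [prod_const, card_sdiff_of_subset hE, prod_ite, prod_const, prod_const,
    filter_mem_eq_inter, mul_pow]
  have : #E = #(E ∩ P) + #(E.filter (· ∉ P)) := by
    rw [← filter_mem_eq_inter, card_filter_add_card_filter_not]
  rw [this, pow_add]; ring

theorem binomExp_one {p : ℝ} {B : Finset α} : binomExp p B (fun _ => 1) = 1 := by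
  simpa using binomExp_pow_card_inter (p := p) (empty_subset B) 1

theorem binomExp_union {p : ℝ} {B₁ B₂ : Finset α} (hd : Disjoint B₁ B₂)
    (h : Finset α → Finset α → ℝ) :
    binomExp p (B₁ ∪ B₂) (fun E => h (E ∩ B₁) (E ∩ B₂)) =
      binomExp p B₂ (fun E₂ => binomExp p B₁ (fun E₁ => h E₁ E₂)) := by
  simp only [binomExp, mul_sum]
  rw [← sum_product']
  refine (sum_nbij' (fun x => x.2 ∪ x.1) (fun E => (E ∩ B₂, E ∩ B₁)) ?_ ?_ ?_ ?_ ?_).symm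
  · rintro ⟨x, y⟩ hx
    simp only [mem_product, mem_powerset] at hx ⊢
    exact union_subset_union hx.2 hx.1
  · intro E _
    simp [mem_product, mem_powerset, inter_subset_right]
  · rintro ⟨x, y⟩ hx
    simp only [mem_product, mem_powerset] at hx
    have h1 : y ∩ B₂ = ∅ := disjoint_iff_inter_eq_empty.1 (hd.mono_left hx.2)
    have h2 : x ∩ B₁ = ∅ := disjoint_iff_inter_eq_empty.1 (hd.symm.mono_left hx.1)
    simp [union_inter_distrib_right, h1, h2, inter_eq_left.2 hx.1, inter_eq_left.2 hx.2]
  · intro E hE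
    simp only [mem_powerset] at hE
    simp only
    rw [← inter_union_distrib_left, inter_eq_left.2 hE]
  · rintro ⟨x, y⟩ hx
    simp only [mem_product, mem_powerset] at hx
    have h1 : y ∩ B₂ = ∅ := disjoint_iff_inter_eq_empty.1 (hd.mono_left hx.2)
    have h2 : x ∩ B₁ = ∅ := disjoint_iff_inter_eq_empty.1 (hd.symm.mono_left hx.1)
    have h3 : #(y ∪ x) = #y + #x := card_union_of_disjoint ((hd.mono_left hx.2).mono_right hx.1)
    have h4 : #B₁ + #B₂ - (#y + #x) = (#B₁ - #y) + (#B₂ - #x) := by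
      have := card_le_card hx.1
      have := card_le_card hx.2
      omega
    simp only [union_inter_distrib_right, h1, h2, inter_eq_left.2 hx.1, inter_eq_left.2 hx.2,
      union_empty, empty_union, h3, card_union_of_disjoint hd, h4, pow_add]
    ring

/-- Transfer from the independent model to subsets of fixed size. -/
theorem card_filter_powersetCard_le {α : Type*} {B : Finset α} {m : ℕ} (hm : m ≤ #B) (hB : 0 < #B)
    (ev : Finset α → Prop) :
    (#((B.powersetCard m).filter ev) : ℝ) ≤
      (#B).choose m * ((#B + 1) * binomExp (m / #B : ℝ) B (fun E => if ev E then 1 else 0)) := by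
  set p : ℝ := m / #B with hp
  have hB' : (0 : ℝ) < #B := by exact_mod_cast hB
  have hp0 : 0 ≤ p := by positivity
  have hp1 : 0 ≤ 1 - p := by
    have : p ≤ 1 := by
      rw [hp, div_le_one hB']; exact_mod_cast hm
    linarith
  have hmode := one_le_succ_mul_binomial_mode hm hB
  rw [← hp] at hmode
  have h1 : (#((B.powersetCard m).filter ev) : ℝ) * (p ^ m * (1 - p) ^ (#B - m)) ≤
      binomExp p B (fun E => if ev E then 1 else 0) := by
    rw [binomExp]
    calc (#((B.powersetCard m).filter ev) : ℝ) * (p ^ m * (1 - p) ^ (#B - m))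
        = ∑ E ∈ (B.powersetCard m).filter ev,
            p ^ #E * (1 - p) ^ (#B - #E) * (if ev E then 1 else 0) := by
          rw [← nsmul_eq_mul, ← sum_const]
          refine sum_congr rfl fun E hE => ?_
          rw [mem_filter, mem_powersetCard] at hE
          simp [hE.1.2, hE.2]
      _ ≤ _ := by
          refine sum_le_sum_of_subset_of_nonneg ?_ ?_
          · intro E hE
            rw [mem_filter, mem_powersetCard] at hE
            exact mem_powerset.2 hE.1.1
          · intro E _ _
            have : (0 : ℝ) ≤ if ev E then 1 else 0 := by split_ifs <;> norm_num
            positivity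
  calc (#((B.powersetCard m).filter ev) : ℝ)
      = #((B.powersetCard m).filter ev) * 1 := by ring
    _ ≤ #((B.powersetCard m).filter ev) *
          ((#B + 1) * ((#B).choose m * (p ^ m * (1 - p) ^ (#B - m)))) := by gcongr
    _ = (#B).choose m * ((#B + 1) *
          (#((B.powersetCard m).filter ev) * (p ^ m * (1 - p) ^ (#B - m)))) := by ring
    _ ≤ _ := by gcongr
end

section
open scoped Classical
open Finset

variable {n k : ℕ}

/-- The vertices of color `j`. -/
noncomputable def colorClass (σ : Fin n → Fin k) (j : Fin k) : Finset (Fin n) :=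
  univ.filter (fun v => σ v = j)

/-- The pairs of vertices whose colors differ. -/
noncomputable def bichrom (σ : Fin n → Fin k) : Finset (Sym2 (Fin n)) :=
  univ.filter (fun e => ¬ (e.map σ).IsDiag)

/-- The vertices `u ∈ W` such that `{v, u}` belongs to `E`. -/
noncomputable def nbrsIn (E : Finset (Sym2 (Fin n))) (v : Fin n) (W : Finset (Fin n)) :
    Finset (Fin n) :=
  W.filter (fun u => s(v, u) ∈ E)

/-- The pairs `{v, u}` with `v ∈ A` and `u ∈ W v`. -/
noncomputable def pairSet (A : Finset (Fin n)) (W : Fin n → Finset (Fin n)) :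
    Finset (Sym2 (Fin n)) :=
  (A.sigma W).image (fun x => s(x.1, x.2))

theorem mem_colorClass {σ : Fin n → Fin k} {j : Fin k} {v : Fin n} :
    v ∈ colorClass σ j ↔ σ v = j := by simp [colorClass]

theorem mk_mem_bichrom {σ : Fin n → Fin k} {u v : Fin n} :
    s(u, v) ∈ bichrom σ ↔ σ u ≠ σ v := by simp [bichrom]

theorem mem_nbrsIn {E : Finset (Sym2 (Fin n))} {v u : Fin n} {W : Finset (Fin n)} :
    u ∈ nbrsIn E v W ↔ u ∈ W ∧ s(v, u) ∈ E := by simp [nbrsIn]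

theorem nbrsIn_mono {E : Finset (Sym2 (Fin n))} {v : Fin n} {W W' : Finset (Fin n)}
    (h : W ⊆ W') : nbrsIn E v W ⊆ nbrsIn E v W' := filter_subset_filter _ h

theorem card_pairSet_le (A : Finset (Fin n)) (W : Fin n → Finset (Fin n)) :
    #(pairSet A W) ≤ ∑ v ∈ A, #(W v) := by
  rw [← card_sigma]; exact card_image_le

theorem card_pairSet {A : Finset (Fin n)} {W : Fin n → Finset (Fin n)}
    (h : ∀ v ∈ A, ∀ u ∈ W v, u ∉ A) : #(pairSet A W) = ∑ v ∈ A, #(W v) := by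
  rw [← card_sigma, pairSet, card_image_of_injOn]
  rintro ⟨v, u⟩ hx ⟨v', u'⟩ hx' heq
  simp only [mem_coe, mem_sigma] at hx hx'
  simp only [Sym2.eq_iff] at heq
  rcases heq with ⟨rfl, rfl⟩ | ⟨rfl, rfl⟩
  · rfl
  · exact absurd hx'.1 (h _ hx.1 _ hx.2)

theorem pairSet_subset_bichrom {σ : Fin n → Fin k} {A : Finset (Fin n)}
    {W : Fin n → Finset (Fin n)} (h : ∀ v ∈ A, ∀ u ∈ W v, σ v ≠ σ u) :
    pairSet A W ⊆ bichrom σ := by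
  intro e he
  simp only [pairSet, mem_image, mem_sigma] at he
  obtain ⟨⟨v, u⟩, hx, rfl⟩ := he
  exact mk_mem_bichrom.2 (h _ hx.1 _ hx.2)

theorem inter_pairSet (E : Finset (Sym2 (Fin n))) (A : Finset (Fin n))
    (W : Fin n → Finset (Fin n)) :
    E ∩ pairSet A W = pairSet A (fun v => nbrsIn E v (W v)) := by
  ext e
  simp only [pairSet, mem_inter, mem_image, mem_sigma, mem_nbrsIn]
  constructor
  · rintro ⟨he, ⟨v, u⟩, hx, rfl⟩
    exact ⟨⟨v, u⟩, ⟨hx.1, hx.2, he⟩, rfl⟩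
  · rintro ⟨⟨v, u⟩, hx, rfl⟩
    exact ⟨hx.2.2, ⟨v, u⟩, ⟨hx.1, hx.2.1⟩, rfl⟩

theorem sum_card_le_two_mul_card_pairSet (A : Finset (Fin n)) (W : Fin n → Finset (Fin n)) :
    ∑ v ∈ A, #(W v) ≤ 2 * #(pairSet A W) := by
  rw [← card_sigma, pairSet]
  refine card_le_mul_card_image _ 2 fun e _ => ?_
  induction e with
  | h a b =>
    refine (card_le_card (t := {⟨a, b⟩, ⟨b, a⟩}) ?_).trans card_le_two
    rintro ⟨v, u⟩ hx
    simp only [mem_filter, Sym2.eq_iff] at hx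
    rcases hx.2 with ⟨rfl, rfl⟩ | ⟨rfl, rfl⟩ <;> simp

/-- The choices of a color different from `σ v` for every `v ∈ A`, extended by `σ` outside `A`. -/
noncomputable def recolorings (σ : Fin n → Fin k) (A : Finset (Fin n)) :
    Finset (Fin n → Fin k) :=
  Fintype.piFinset (fun v => if v ∈ A then univ.filter (· ≠ σ v) else {σ v})

theorem card_recolorings_le (σ : Fin n → Fin k) (A : Finset (Fin n)) :
    #(recolorings σ A) ≤ k ^ #A := by
  rw [recolorings, Fintype.card_piFinset]
  calc _ ≤ ∏ v : Fin n, (if v ∈ A then k else 1) := by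
        refine prod_le_prod' fun v _ => ?_
        split_ifs
        · exact (card_filter_le _ _).trans (by simp)
        · simp
    _ = _ := by rw [prod_ite]; simp

theorem exists_mem_recolorings {σ : Fin n → Fin k} {A : Finset (Fin n)}
    {q : Fin n → Fin k → Prop} (h : ∀ v ∈ A, ∃ j, j ≠ σ v ∧ q v j) :
    ∃ f ∈ recolorings σ A, ∀ v ∈ A, q v (f v) := by
  choose f hf using h
  refine ⟨fun v => if hv : v ∈ A then f v hv else σ v, ?_, fun v hv => ?_⟩
  · simp only [recolorings, Fintype.mem_piFinset]
    intro v
    by_cases hv : v ∈ A <;> simp [hv]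
    exact (hf v hv).1
  · simp only [hv, dif_pos]; exact (hf v hv).2

theorem ne_of_mem_recolorings {σ f : Fin n → Fin k} {A : Finset (Fin n)}
    (hf : f ∈ recolorings σ A) {v : Fin n} (hv : v ∈ A) : f v ≠ σ v := by
  have := Fintype.mem_piFinset.1 hf v
  simpa [hv] using this

theorem binomExp_few_nbrs_le {p : ℝ} (hp0 : 0 ≤ p) (hp1 : p ≤ 1) (σ : Fin n → Fin k)
    {A Y : Finset (Fin n)} (hAY : A ⊆ Y) (R : ℕ) {M : ℝ}
    (hM : ∀ j, M ≤ #(colorClass σ j \ Y)) :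
    binomExp p (bichrom σ) (fun E => if ∀ v ∈ A, ∃ j, j ≠ σ v ∧
        #(nbrsIn E v (colorClass σ j \ Y)) ≤ R then 1 else 0) ≤
      (k * Real.exp (5 * R) * Real.exp (-(p * (1 - Real.exp (-5)) * M))) ^ #A := by
  set c : ℝ := Real.exp (-5) with hc
  have hc0 : 0 < c := Real.exp_pos _
  have hc1 : c < 1 := by rw [hc, Real.exp_lt_one_iff]; norm_num
  set W : (Fin n → Fin k) → Fin n → Finset (Fin n) := fun f v => colorClass σ (f v) \ Y with hW
  have hpt : ∀ E ⊆ bichrom σ, (if ∀ v ∈ A, ∃ j, j ≠ σ v ∧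
        #(nbrsIn E v (colorClass σ j \ Y)) ≤ R then (1 : ℝ) else 0) ≤
      ∑ f ∈ recolorings σ A, Real.exp (5 * R) ^ #A * c ^ #(E ∩ pairSet A (W f)) := by
    intro E _
    split_ifs with hE
    · obtain ⟨f, hf, hfv⟩ := exists_mem_recolorings hE
      refine le_trans ?_ (single_le_sum (f := fun f => Real.exp (5 * R) ^ #A *
        c ^ #(E ∩ pairSet A (W f))) (fun _ _ => by positivity) hf)
      have hcard : #(E ∩ pairSet A (W f)) ≤ R * #A := by
        rw [inter_pairSet]
        refine (card_pairSet_le _ _).trans ?_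
        rw [mul_comm]
        exact sum_le_card_nsmul _ _ _ hfv
      have : c ^ (R * #A) ≤ c ^ #(E ∩ pairSet A (W f)) :=
        pow_le_pow_of_le_one hc0.le hc1.le hcard
      calc (1 : ℝ) = Real.exp (5 * R) ^ #A * c ^ (R * #A) := by
            rw [hc, ← Real.exp_nat_mul, ← Real.exp_nat_mul, ← Real.exp_add]
            rw [eq_comm, Real.exp_eq_one_iff]; push_cast; ring
        _ ≤ _ := by gcongr
    · exact sum_nonneg fun _ _ => by positivity
  refine (binomExp_mono hp0 hp1 hpt).trans ?_
  rw [binomExp_sum]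
  have hterm : ∀ f ∈ recolorings σ A, binomExp p (bichrom σ)
      (fun E => Real.exp (5 * R) ^ #A * c ^ #(E ∩ pairSet A (W f))) ≤
      (Real.exp (5 * R) * Real.exp (-(p * (1 - c) * M))) ^ #A := by
    intro f hf
    have hsub : pairSet A (W f) ⊆ bichrom σ := by
      refine pairSet_subset_bichrom fun v hv u hu => ?_
      simp only [hW, Finset.mem_sdiff, mem_colorClass] at hu
      rw [hu.1]
      exact (ne_of_mem_recolorings hf hv).symm
    rw [binomExp_const_mul, binomExp_pow_card_inter hsub, mul_pow]
    refine mul_le_mul_of_nonneg_left ?_ (by positivity)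
    have h1 : (0 : ℝ) ≤ 1 - p + p * c := by nlinarith
    have h2 : 1 - p + p * c ≤ Real.exp (-(p * (1 - c))) := by
      have := Real.add_one_le_exp (-(p * (1 - c))); linarith
    have hcard : (#A : ℝ) * M ≤ #(pairSet A (W f)) := by
      rw [card_pairSet]
      · rw [Nat.cast_sum, ← nsmul_eq_mul]
        exact card_nsmul_le_sum _ _ _ fun v _ => hM (f v)
      · intro v _ u hu huA
        simp only [hW, Finset.mem_sdiff] at hu
        exact hu.2 (hAY huA)
    refine (pow_le_pow_left₀ h1 h2 _).trans ?_
    rw [← Real.exp_nat_mul, ← Real.exp_nat_mul, Real.exp_le_exp]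
    have h3 : 0 ≤ p * (1 - c) := mul_nonneg hp0 (by linarith)
    nlinarith
  refine (sum_le_card_nsmul _ _ _ hterm).trans ?_
  rw [nsmul_eq_mul, mul_assoc (k : ℝ), mul_pow (k : ℝ)]
  refine mul_le_mul_of_nonneg_right ?_ (by positivity)
  exact_mod_cast card_recolorings_le σ A

/-- The vertices outside `X` that have at most `R` neighbors outside `X` of some color different
from their own. -/
noncomputable def sparseSet (E : Finset (Sym2 (Fin n))) (σ : Fin n → Fin k) (R : ℕ)
    (X : Finset (Fin n)) : Finset (Fin n) :=
  univ.filter (fun v => v ∉ X ∧ ∃ j, j ≠ σ v ∧ #(nbrsIn E v (colorClass σ j \ X)) ≤ R)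

theorem binomExp_many_nbrs_le {p : ℝ} (hp0 : 0 ≤ p) (hp1 : p ≤ 1) (σ : Fin n → Fin k)
    (X : Finset (Fin n)) (R : ℕ) {z s : ℝ} (hs : 0 ≤ s) :
    binomExp p (bichrom σ) (fun E => if
        (∀ j, (#(sparseSet E σ R X ∩ colorClass σ j) : ℝ) ≤ z) ∧
        ∀ x ∈ X, ∃ j, j ≠ σ x ∧
          R ≤ #(nbrsIn E x ((sparseSet E σ R X ∪ X) ∩ colorClass σ j)) then 1 else 0) ≤
      (k * Real.exp (-(s * R)) * Real.exp (p * Real.exp (2 * s) * (z + #X))) ^ #X := by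
  set B₁ := (bichrom σ).filter (fun e => ∃ x ∈ X, x ∈ e) with hB₁
  set B₂ := (bichrom σ).filter (fun e => ¬ ∃ x ∈ X, x ∈ e) with hB₂
  have hd : Disjoint B₁ B₂ := disjoint_filter_filter_not _ _ _
  have hB : bichrom σ = B₁ ∪ B₂ := (filter_union_filter_not_eq _ _).symm
  have hsp : ∀ E ⊆ bichrom σ, sparseSet E σ R X = sparseSet (E ∩ B₂) σ R X := by
    intro E hE
    ext v
    simp only [sparseSet, mem_filter, mem_univ, true_and]
    refine and_congr_right fun hv => exists_congr fun j => and_congr_right fun _ => ?_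
    have : nbrsIn E v (colorClass σ j \ X) = nbrsIn (E ∩ B₂) v (colorClass σ j \ X) := by
      ext u
      simp only [mem_nbrsIn, mem_inter, Finset.mem_sdiff]
      refine and_congr_right fun hu => ⟨fun h => ⟨h, ?_⟩, fun h => h.1⟩
      rw [hB₂, mem_filter]
      refine ⟨hE h, ?_⟩
      rintro ⟨x, hx, hxe⟩
      rcases Sym2.mem_iff.1 hxe with rfl | rfl
      · exact hv hx
      · exact hu.2 hx
    rw [this]
  have hnb : ∀ E ⊆ bichrom σ, ∀ x ∈ X, ∀ W, nbrsIn E x W = nbrsIn (E ∩ B₁) x W := by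
    intro E hE x hx W
    ext u
    simp only [mem_nbrsIn, mem_inter]
    refine and_congr_right fun hu => ⟨fun h => ⟨h, ?_⟩, fun h => h.1⟩
    rw [hB₁, mem_filter]
    exact ⟨hE h, x, hx, Sym2.mem_mk_left _ _⟩
  set h : Finset (Sym2 (Fin n)) → Finset (Sym2 (Fin n)) → ℝ := fun E₁ E₂ => if
        (∀ j, (#(sparseSet E₂ σ R X ∩ colorClass σ j) : ℝ) ≤ z) ∧
        ∀ x ∈ X, ∃ j, j ≠ σ x ∧
          R ≤ #(nbrsIn E₁ x ((sparseSet E₂ σ R X ∪ X) ∩ colorClass σ j)) then 1 else 0 with hh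
  have step1 : binomExp p (bichrom σ) (fun E => if
        (∀ j, (#(sparseSet E σ R X ∩ colorClass σ j) : ℝ) ≤ z) ∧
        ∀ x ∈ X, ∃ j, j ≠ σ x ∧
          R ≤ #(nbrsIn E x ((sparseSet E σ R X ∪ X) ∩ colorClass σ j)) then 1 else 0) ≤
      binomExp p (bichrom σ) (fun E => h (E ∩ B₁) (E ∩ B₂)) := by
    refine binomExp_mono hp0 hp1 fun E hE => ?_
    simp only [hh, ← hsp E hE]
    refine le_of_eq ?_
    congr 1
    refine propext (and_congr_right fun _ => forall₂_congr fun x hx => ?_)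
    simp only [hnb E hE x hx]
  refine step1.trans ?_
  rw [hB, binomExp_union hd]
  set D := (k * Real.exp (-(s * R)) * Real.exp (p * Real.exp (2 * s) * (z + #X))) ^ #X with hD
  have hD0 : 0 ≤ D := by positivity
  have inner : ∀ E₂ ⊆ B₂, binomExp p B₁ (fun E₁ => h E₁ E₂) ≤ D * 1 := by
    intro E₂ _
    rw [mul_one]
    set Z := sparseSet E₂ σ R X with hZ
    by_cases hgood : ∀ j, (#(Z ∩ colorClass σ j) : ℝ) ≤ z
    swap
    · have : (fun E₁ => h E₁ E₂) = fun _ => 0 * 1 := by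
        funext E₁
        simp only [hh, ← hZ]
        rw [if_neg (fun h => hgood h.1)]; ring
      rw [this, binomExp_const_mul]; simpa using hD0
    set c : ℝ := Real.exp (2 * s) with hc
    have hc1 : 1 ≤ c := Real.one_le_exp (by linarith)
    set W : (Fin n → Fin k) → Fin n → Finset (Fin n) :=
      fun f v => (Z ∪ X) ∩ colorClass σ (f v) with hW
    have hpt : ∀ E ⊆ B₁, h E E₂ ≤ ∑ f ∈ recolorings σ X,
        Real.exp (-(s * R)) ^ #X * c ^ #(E ∩ pairSet X (W f)) := by
      intro E _
      simp only [hh, ← hZ]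
      split_ifs with hE
      · obtain ⟨f, hf, hfv⟩ := exists_mem_recolorings hE.2
        refine le_trans ?_ (single_le_sum (f := fun f => Real.exp (-(s * R)) ^ #X *
          c ^ #(E ∩ pairSet X (W f))) (fun _ _ => by positivity) hf)
        have hcard : (#X : ℝ) * R ≤ 2 * #(E ∩ pairSet X (W f)) := by
          rw [inter_pairSet]
          have h1 := sum_card_le_two_mul_card_pairSet X (fun v => nbrsIn E v (W f v))
          have h2 := card_nsmul_le_sum X (fun v => #(nbrsIn E v (W f v))) R hfv
          rw [smul_eq_mul] at h2
          exact_mod_cast h2.trans h1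
        rw [hc, ← Real.exp_nat_mul, ← Real.exp_nat_mul, ← Real.exp_add]
        refine Real.one_le_exp ?_
        nlinarith
      · exact sum_nonneg fun _ _ => by positivity
    refine (binomExp_mono hp0 hp1 hpt).trans ?_
    rw [binomExp_sum]
    have hterm : ∀ f ∈ recolorings σ X, binomExp p B₁
        (fun E => Real.exp (-(s * R)) ^ #X * c ^ #(E ∩ pairSet X (W f))) ≤
        (Real.exp (-(s * R)) * Real.exp (p * c * (z + #X))) ^ #X := by
      intro f hf
      have hsub : pairSet X (W f) ⊆ B₁ := by
        intro e he
        rw [hB₁, mem_filter]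
        refine ⟨pairSet_subset_bichrom (fun v hv u hu => ?_) he, ?_⟩
        · simp only [hW, mem_inter, mem_colorClass] at hu
          rw [hu.2]
          exact (ne_of_mem_recolorings hf hv).symm
        · simp only [pairSet, mem_image, mem_sigma] at he
          obtain ⟨⟨v, u⟩, hx, rfl⟩ := he
          exact ⟨v, hx.1, Sym2.mem_mk_left _ _⟩
      rw [binomExp_const_mul, binomExp_pow_card_inter hsub, mul_pow]
      refine mul_le_mul_of_nonneg_left ?_ (by positivity)
      have h1 : (1 : ℝ) ≤ 1 - p + p * c := by nlinarith
      have h2 : 1 - p + p * c ≤ Real.exp (p * c) := by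
        have := Real.add_one_le_exp (p * c); linarith
      have hcard : (#(pairSet X (W f)) : ℝ) ≤ #X * (z + #X) := by
        have h3 : (#(pairSet X (W f)) : ℝ) ≤ ∑ v ∈ X, (#(W f v) : ℝ) := by
          exact_mod_cast card_pairSet_le X (W f)
        refine h3.trans ?_
        rw [← nsmul_eq_mul]
        refine sum_le_card_nsmul _ _ _ fun v _ => ?_
        have h4 : #(W f v) ≤ #(Z ∩ colorClass σ (f v)) + #X := by
          simp only [hW, union_inter_distrib_right]
          exact (card_union_le _ _).trans (by gcongr; exact inter_subset_left)
        have h5 := hgood (f v)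
        have h6 : (#(W f v) : ℝ) ≤ #(Z ∩ colorClass σ (f v)) + #X := by exact_mod_cast h4
        linarith
      refine (pow_le_pow_left₀ (by linarith) h2 _).trans ?_
      rw [← Real.exp_nat_mul, ← Real.exp_nat_mul, Real.exp_le_exp]
      have h3 : 0 ≤ p * c := mul_nonneg hp0 (by linarith)
      nlinarith
    refine (sum_le_card_nsmul _ _ _ hterm).trans ?_
    rw [nsmul_eq_mul, hD, mul_assoc (k : ℝ), mul_pow (k : ℝ)]
    refine mul_le_mul_of_nonneg_right ?_ (by positivity)
    exact_mod_cast card_recolorings_le σ X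
  refine (binomExp_mono hp0 hp1 inner).trans ?_
  rw [binomExp_const_mul, binomExp_one, mul_one]

/-- Up to a set `X` of at most `x₀` vertices, there is a set `A` of at least `a I` vertices with
colors in `I`, at most `z` of each color, all of whose elements have at most `R` neighbors
outside `X ∪ A` of some color different from their own. -/
def HasSparseBlock (E : Finset (Sym2 (Fin n))) (σ : Fin n → Fin k) (R x₀ z : ℕ)
    (a : Finset (Fin k) → ℝ) : Prop :=
  ∃ (I : Finset (Fin k)) (X A : Finset (Fin n)), #X ≤ x₀ ∧ (∀ v ∈ A, σ v ∈ I) ∧ a I ≤ #A ∧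
    (∀ j, #(A ∩ colorClass σ j) ≤ z) ∧
    ∀ v ∈ A, ∃ j, j ≠ σ v ∧ #(nbrsIn E v (colorClass σ j \ (X ∪ A))) ≤ R

/-- There is a set `X` of `x₀` vertices, all of which have at least `R` neighbors in `X` and the
sparse set of `X` of some color different from their own. -/
def HasDenseSpread (E : Finset (Sym2 (Fin n))) (σ : Fin n → Fin k) (R x₀ z : ℕ) : Prop :=
  ∃ X : Finset (Fin n), #X = x₀ ∧
    (∀ j, (#(sparseSet E σ R X ∩ colorClass σ j) : ℝ) ≤ z) ∧
    ∀ x ∈ X, ∃ j, j ≠ σ x ∧ R ≤ #(nbrsIn E x ((sparseSet E σ R X ∪ X) ∩ colorClass σ j))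

theorem sum_powerset_pow_card {ι : Type*} (W : Finset ι) (c : ℝ) :
    ∑ A ∈ W.powerset, c ^ #A = (1 + c) ^ #W := by
  rw [add_comm, ← sum_pow_mul_eq_add_pow]; simp

theorem sum_powerset_exp_le {ι : Type*} (W : Finset ι) (s : ℝ) :
    ∑ A ∈ W.powerset, Real.exp (-s) ^ #A ≤ Real.exp (#W * Real.exp (-s)) := by
  rw [sum_powerset_pow_card, Real.exp_nat_mul]
  refine pow_le_pow_left₀ (by positivity) ?_ _
  have := Real.add_one_le_exp (Real.exp (-s)); linarith

theorem card_filter_card_le_le {L : ℝ} (hL : 0 ≤ L) (x₀ : ℕ) :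
    (#((univ : Finset (Finset (Fin n))).filter (fun X => #X ≤ x₀)) : ℝ) ≤
      Real.exp (L * x₀ + n * Real.exp (-L)) := by
  have h1 : (#((univ : Finset (Finset (Fin n))).filter (fun X => #X ≤ x₀)) : ℝ) ≤
      ∑ X ∈ (univ : Finset (Fin n)).powerset, Real.exp (L * x₀) * Real.exp (-L) ^ #X := by
    rw [← nsmul_one, ← sum_const]
    refine (sum_le_sum fun X hX => ?_).trans
      (sum_le_sum_of_subset_of_nonneg ?_ fun _ _ _ => by positivity)
    · rw [← Real.exp_nat_mul, ← Real.exp_add]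
      refine Real.one_le_exp ?_
      have : (#X : ℝ) ≤ x₀ := by exact_mod_cast (mem_filter.1 hX).2
      nlinarith
    · intro X _; simp
  refine h1.trans ?_
  rw [← mul_sum, Real.exp_add]
  have := sum_powerset_exp_le (univ : Finset (Fin n)) L
  rw [card_univ, Fintype.card_fin] at this
  gcongr

theorem binomExp_hasSparseBlock_le {p : ℝ} (hp0 : 0 ≤ p) (hp1 : p ≤ 1) (σ : Fin n → Fin k)
    (R x₀ z : ℕ) (a : Finset (Fin k) → ℝ) {M L a₀ : ℝ} (hL : 10 ≤ L)
    (hM : ∀ j, M + x₀ + z ≤ #(colorClass σ j))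
    (hMp : k * Real.exp (5 * R) * Real.exp (-(p * (1 - Real.exp (-5)) * M)) ≤
      Real.exp (-(0.9 * L)))
    (ha₀ : ∀ I, a₀ ≤ a I)
    (ha : ∀ I, #(univ.filter (fun v => σ v ∈ I)) * Real.exp (-(0.7 * L)) ≤ a I) :
    binomExp p (bichrom σ) (fun E => if HasSparseBlock E σ R x₀ z a then 1 else 0) ≤
      2 ^ k * (Real.exp (L * x₀ + n * Real.exp (-L)) * Real.exp (-(0.1 * L * a₀))) := by
  set ev : Finset (Fin n) → Finset (Fin n) → Finset (Sym2 (Fin n)) → ℝ := fun X A E =>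
    if ∀ v ∈ A, ∃ j, j ≠ σ v ∧ #(nbrsIn E v (colorClass σ j \ (X ∪ A))) ≤ R then 1 else 0
    with hev
  have hev0 : ∀ X A E, 0 ≤ ev X A E := by
    intro X A E; simp only [hev]; split_ifs <;> norm_num
  set S : Finset (Fin k) → Finset (Finset (Fin n)) := fun I =>
    (univ.filter (fun v => σ v ∈ I)).powerset.filter
      (fun A => a I ≤ #A ∧ ∀ j, #(A ∩ colorClass σ j) ≤ z) with hS
  set T : Finset (Finset (Fin n)) := univ.filter (fun X => #X ≤ x₀) with hT
  have hpt : ∀ E ⊆ bichrom σ, (if HasSparseBlock E σ R x₀ z a then (1 : ℝ) else 0) ≤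
      ∑ I : Finset (Fin k), ∑ X ∈ T, ∑ A ∈ S I, ev X A E := by
    intro E _
    split_ifs with hE
    · obtain ⟨I, X, A, hX, hAI, haA, hAz, hA⟩ := hE
      have hXT : X ∈ T := by simp [hT, hX]
      have hAS : A ∈ S I := by
        simp only [hS, mem_filter, mem_powerset]
        exact ⟨fun v hv => by simpa using hAI v hv, haA, hAz⟩
      calc (1 : ℝ) = ev X A E := by simp only [hev]; rw [if_pos hA]
        _ ≤ ∑ A ∈ S I, ev X A E := single_le_sum (fun A _ => hev0 X A E) hAS
        _ ≤ ∑ X ∈ T, ∑ A ∈ S I, ev X A E :=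
          single_le_sum (f := fun X => ∑ A ∈ S I, ev X A E)
            (fun X _ => sum_nonneg fun A _ => hev0 X A E) hXT
        _ ≤ _ := single_le_sum (f := fun I => ∑ X ∈ T, ∑ A ∈ S I, ev X A E)
            (fun I _ => sum_nonneg fun X _ => sum_nonneg fun A _ => hev0 X A E) (mem_univ I)
    · exact sum_nonneg fun _ _ => sum_nonneg fun _ _ => sum_nonneg fun _ _ => hev0 _ _ _
  refine (binomExp_mono hp0 hp1 hpt).trans ?_
  rw [binomExp_sum]
  have hI : ∀ I ∈ (univ : Finset (Finset (Fin k))),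
      binomExp p (bichrom σ) (fun E => ∑ X ∈ T, ∑ A ∈ S I, ev X A E) ≤
        Real.exp (L * x₀ + n * Real.exp (-L)) * Real.exp (-(0.1 * L * a₀)) := by
    intro I _
    rw [binomExp_sum]
    have hX : ∀ X ∈ T, binomExp p (bichrom σ) (fun E => ∑ A ∈ S I, ev X A E) ≤
        Real.exp (-(0.1 * L * a₀)) := by
      intro X hX
      have hXx : #X ≤ x₀ := (mem_filter.1 hX).2
      rw [binomExp_sum]
      have hA : ∀ A ∈ S I, binomExp p (bichrom σ) (ev X A) ≤
          Real.exp (-(0.2 * L * a I)) * Real.exp (-(0.7 * L)) ^ #A := by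
        intro A hA
        simp only [hS, mem_filter, mem_powerset] at hA
        have hMj : ∀ j, M ≤ #(colorClass σ j \ (X ∪ A)) := by
          intro j
          have h1 : #(colorClass σ j) ≤
              #(colorClass σ j \ (X ∪ A)) + (#X + #(A ∩ colorClass σ j)) := by
            refine (card_le_card (t := (colorClass σ j \ (X ∪ A)) ∪
              (X ∪ (A ∩ colorClass σ j))) ?_).trans
              ((card_union_le _ _).trans (by gcongr; exact card_union_le _ _))
            intro v hv
            simp only [mem_union, Finset.mem_sdiff, mem_inter]
            tauto
          have h2 := hA.2.2 j
          have h3 : #(colorClass σ j) ≤ #(colorClass σ j \ (X ∪ A)) + (x₀ + z) := by omega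
          have h4 : (#(colorClass σ j) : ℝ) ≤ #(colorClass σ j \ (X ∪ A)) + (x₀ + z) := by
            exact_mod_cast h3
          linarith [hM j]
        refine (binomExp_few_nbrs_le hp0 hp1 σ subset_union_right R hMj).trans ?_
        refine (pow_le_pow_left₀ (by positivity) hMp _).trans ?_
        rw [← Real.exp_nat_mul, ← Real.exp_nat_mul, ← Real.exp_add, Real.exp_le_exp]
        nlinarith [hA.2.1]
      refine (sum_le_sum hA).trans ?_
      rw [← mul_sum]
      have h1 : ∑ A ∈ S I, Real.exp (-(0.7 * L)) ^ #A ≤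
          Real.exp (#(univ.filter (fun v => σ v ∈ I)) * Real.exp (-(0.7 * L))) :=
        (sum_le_sum_of_subset_of_nonneg (filter_subset _ _)
          (fun _ _ _ => by positivity)).trans (sum_powerset_exp_le _ _)
      refine (mul_le_mul_of_nonneg_left h1 (by positivity)).trans ?_
      rw [← Real.exp_add, Real.exp_le_exp]
      have h2 := ha I
      have h3 : 0 ≤ a I := le_trans (by positivity) h2
      nlinarith [ha₀ I]
    refine (sum_le_card_nsmul _ _ _ hX).trans ?_
    rw [nsmul_eq_mul]
    exact mul_le_mul_of_nonneg_right (card_filter_card_le_le (by linarith) x₀) (by positivity)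
  refine (sum_le_card_nsmul _ _ _ hI).trans (le_of_eq ?_)
  rw [nsmul_eq_mul]; simp

theorem binomExp_hasDenseSpread_le {p : ℝ} (hp0 : 0 ≤ p) (hp1 : p ≤ 1) (σ : Fin n → Fin k)
    (R x₀ z : ℕ) {L s : ℝ} (hL : 0 ≤ L) (hs : 0 ≤ s)
    (hb : k * Real.exp (-(s * R)) * Real.exp (p * Real.exp (2 * s) * (z + x₀)) ≤
      Real.exp (-(10 * L))) :
    binomExp p (bichrom σ) (fun E => if HasDenseSpread E σ R x₀ z then 1 else 0) ≤
      Real.exp (n * Real.exp (-L) - 9 * L * x₀) := by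
  set T : Finset (Finset (Fin n)) := univ.filter (fun X => #X ≤ x₀) with hT
  set ev : Finset (Fin n) → Finset (Sym2 (Fin n)) → ℝ := fun X E => if
        (∀ j, (#(sparseSet E σ R X ∩ colorClass σ j) : ℝ) ≤ z) ∧
        ∀ x ∈ X, ∃ j, j ≠ σ x ∧
          R ≤ #(nbrsIn E x ((sparseSet E σ R X ∪ X) ∩ colorClass σ j)) then 1 else 0 with hev
  have hev0 : ∀ X E, 0 ≤ ev X E := by
    intro X E; simp only [hev]; split_ifs <;> norm_num
  have hpt : ∀ E ⊆ bichrom σ, (if HasDenseSpread E σ R x₀ z then (1 : ℝ) else 0) ≤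
      ∑ X ∈ T.filter (fun X => #X = x₀), ev X E := by
    intro E _
    split_ifs with hE
    · obtain ⟨X, hX, hE'⟩ := hE
      have hXT : X ∈ T.filter (fun X => #X = x₀) := by simp [hT, hX]
      calc (1 : ℝ) = ev X E := by simp only [hev]; rw [if_pos hE']
        _ ≤ _ := single_le_sum (f := fun X => ev X E) (fun X _ => hev0 X E) hXT
    · exact sum_nonneg fun _ _ => hev0 _ _
  refine (binomExp_mono hp0 hp1 hpt).trans ?_
  rw [binomExp_sum]
  have hX : ∀ X ∈ T.filter (fun X => #X = x₀), binomExp p (bichrom σ) (ev X) ≤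
      Real.exp (-(10 * L)) ^ x₀ := by
    intro X hX
    have hXx : #X = x₀ := (mem_filter.1 hX).2
    refine (binomExp_many_nbrs_le hp0 hp1 σ X R hs).trans ?_
    rw [hXx]
    exact pow_le_pow_left₀ (by positivity) hb _
  refine (sum_le_card_nsmul _ _ _ hX).trans ?_
  rw [nsmul_eq_mul]
  have h1 : (#(T.filter (fun X => #X = x₀)) : ℝ) ≤ Real.exp (L * x₀ + n * Real.exp (-L)) :=
    le_trans (by exact_mod_cast card_filter_le _ _) (card_filter_card_le_le hL x₀)
  refine (mul_le_mul_of_nonneg_right h1 (by positivity)).trans (le_of_eq ?_)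
  rw [← Real.exp_nat_mul, ← Real.exp_add]
  congr 1; ring

theorem card_sparseSet_inter_lt {E : Finset (Sym2 (Fin n))} {σ : Fin n → Fin k} {R x₀ z : ℕ}
    {a : Finset (Fin k) → ℝ} (h : ¬ HasSparseBlock E σ R x₀ z a) (ha : ∀ j, a {j} ≤ z)
    {X : Finset (Fin n)} (hX : #X ≤ x₀) (j : Fin k) :
    #(sparseSet E σ R X ∩ colorClass σ j) < z := by
  by_contra! hz
  obtain ⟨A, hA, hAz⟩ := exists_subset_card_eq hz
  refine h ⟨{j}, X, A, hX, fun v hv => ?_, ?_, fun i => ?_, fun v hv => ?_⟩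
  · simpa [mem_colorClass] using (mem_inter.1 (hA hv)).2
  · rw [hAz]; exact ha j
  · exact (card_le_card inter_subset_left).trans hAz.le
  · have hv' := (mem_inter.1 (hA hv)).1
    simp only [sparseSet, mem_filter, mem_univ, true_and] at hv'
    obtain ⟨i, hi, hc⟩ := hv'.2
    exact ⟨i, hi, (card_le_card (nbrsIn_mono
      (sdiff_subset_sdiff subset_rfl subset_union_left))).trans hc⟩

theorem card_sparseSet_filter_lt {E : Finset (Sym2 (Fin n))} {σ : Fin n → Fin k} {R x₀ z : ℕ}
    {a : Finset (Fin k) → ℝ} (h : ¬ HasSparseBlock E σ R x₀ z a) (ha : ∀ j, a {j} ≤ z)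
    (I : Finset (Fin k)) :
    (#((sparseSet E σ R ∅).filter (fun v => σ v ∈ I)) : ℝ) < a I := by
  by_contra! hI
  refine h ⟨I, ∅, (sparseSet E σ R ∅).filter (fun v => σ v ∈ I), by simp, fun v hv =>
    (mem_filter.1 hv).2, hI, fun j => ?_, fun v hv => ?_⟩
  · exact (card_le_card (inter_subset_inter_right (filter_subset _ _))).trans
      (card_sparseSet_inter_lt h ha (X := ∅) (by simp) j).le
  · have hv' := (mem_filter.1 hv).1
    simp only [sparseSet, mem_filter, mem_univ, true_and] at hv'
    obtain ⟨i, hi, hc⟩ := hv'.2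
    exact ⟨i, hi, (card_le_card (nbrsIn_mono
      (sdiff_subset_sdiff subset_rfl subset_union_left))).trans hc⟩

theorem exists_card_le_forall_notMem_whiteSet {E : Finset (Sym2 (Fin n))} {σ : Fin n → Fin k}
    {R x₀ z : ℕ} {a : Finset (Fin k) → ℝ} (h : ¬ HasSparseBlock E σ R x₀ z a)
    (ha : ∀ j, a {j} ≤ z) (hd : ¬ HasDenseSpread E σ R x₀ z) :
    ∃ X : Finset (Fin n), #X ≤ x₀ ∧
      ∀ v, v ∉ whiteSet E σ → v ∈ sparseSet E σ R ∅ ∪ X := by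
  set U := sparseSet E σ R ∅ with hU
  set F : Finset (Finset (Fin n)) := univ.filter (fun X => #X ≤ x₀ ∧ Disjoint X U ∧
    ∀ x ∈ X, ∃ j, j ≠ σ x ∧ #(nbrsIn E x (colorClass σ j \ (U ∪ X))) ≤ 1) with hF
  have hne : F.Nonempty := ⟨∅, by simp [hF]⟩
  obtain ⟨X, hXF, hmax⟩ := exists_max_image F card hne
  simp only [hF, mem_filter, mem_univ, true_and] at hXF
  obtain ⟨hXx, hXU, hX⟩ := hXF
  refine ⟨X, hXx, ?_⟩
  rcases hXx.lt_or_eq with hlt | heq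
  · intro v hv
    by_contra hvX
    refine hv ⟨{w | w ∉ U ∪ X}, ?_, hvX⟩
    intro w hw j hj
    have hcard : 1 < #(nbrsIn E w (colorClass σ j \ (U ∪ X))) := by
      by_contra! hle
      have hwX : w ∉ X := fun h => hw (mem_union_right _ h)
      have hwU : w ∉ U := fun h => hw (mem_union_left _ h)
      have hmem : insert w X ∈ F := by
        simp only [hF, mem_filter, mem_univ, true_and]
        refine ⟨by rw [card_insert_of_notMem hwX]; omega, ?_, fun x hx => ?_⟩
        · rw [disjoint_insert_left]; exact ⟨hwU, hXU⟩
        · have hmono : ∀ i, colorClass σ i \ (U ∪ insert w X) ⊆ colorClass σ i \ (U ∪ X) :=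
            fun i => sdiff_subset_sdiff subset_rfl
              (union_subset_union subset_rfl (subset_insert _ _))
          rcases mem_insert.1 hx with rfl | hx
          · exact ⟨j, hj, (card_le_card (nbrsIn_mono (hmono j))).trans hle⟩
          · obtain ⟨i, hi, hc⟩ := hX x hx
            exact ⟨i, hi, (card_le_card (nbrsIn_mono (hmono i))).trans hc⟩
      have := hmax _ hmem
      rw [card_insert_of_notMem hwX] at this
      omega
    obtain ⟨u₁, h₁, u₂, h₂, hne⟩ := one_lt_card.1 hcard
    simp only [mem_nbrsIn, Finset.mem_sdiff, mem_colorClass] at h₁ h₂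
    exact ⟨u₁, u₂, h₁.1.2, h₂.1.2, hne, h₁.2, h₂.2, h₁.1.1, h₂.1.1⟩
  · refine absurd ⟨X, heq, fun j => ?_, fun x hx => ?_⟩ hd
    · exact_mod_cast (card_sparseSet_inter_lt h ha hXx j).le
    · obtain ⟨j, hj, hc⟩ := hX x hx
      refine ⟨j, hj, ?_⟩
      have hxU : x ∉ U := disjoint_left.1 hXU hx
      have h1 : R < #(nbrsIn E x (colorClass σ j)) := by
        by_contra! hle
        refine hxU ?_
        simp only [hU, sparseSet, mem_filter, mem_univ, true_and]
        exact ⟨by simp, j, hj, by simpa using hle⟩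
      have h2 : nbrsIn E x (colorClass σ j) ⊆ nbrsIn E x (colorClass σ j \ (U ∪ X)) ∪
          nbrsIn E x ((sparseSet E σ R X ∪ X) ∩ colorClass σ j) := by
        intro u hu
        rw [mem_nbrsIn] at hu
        simp only [mem_union, mem_nbrsIn, Finset.mem_sdiff, mem_inter]
        by_cases huX : u ∈ X
        · exact Or.inr ⟨⟨Or.inr huX, hu.1⟩, hu.2⟩
        by_cases huU : u ∈ U
        · refine Or.inr ⟨⟨Or.inl ?_, hu.1⟩, hu.2⟩
          simp only [hU, sparseSet, mem_filter, mem_univ, true_and] at huU ⊢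
          obtain ⟨i, hi, hci⟩ := huU.2
          exact ⟨huX, i, hi, (card_le_card (nbrsIn_mono
            (sdiff_subset_sdiff subset_rfl (empty_subset _)))).trans hci⟩
        · exact Or.inl ⟨⟨hu.1, by tauto⟩, hu.2⟩
      have h3 := (card_le_card h2).trans (card_union_le _ _)
      omega

theorem sum_card_colorClass (σ : Fin n → Fin k) : ∑ j, #(colorClass σ j) = n := by
  have := card_eq_sum_card_fiberwise (f := σ) (s := univ) (t := univ) (fun _ _ => by simp)
  simpa [colorClass] using this.symm

theorem two_mul_card_bichrom (σ : Fin n → Fin k) :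
    2 * (#(bichrom σ) : ℝ) = n ^ 2 - ∑ j, (#(colorClass σ j) : ℝ) ^ 2 := by
  set G : SimpleGraph (Fin n) := (⊤ : SimpleGraph (Fin k)).comap σ with hG
  have hedge : G.edgeFinset = bichrom σ := by
    ext e
    induction e with
    | h a b => simp [hG, mk_mem_bichrom]
  have hdeg : ∀ v, (G.degree v : ℝ) = n - #(colorClass σ (σ v)) := by
    intro v
    have h1 : G.neighborFinset v = univ \ colorClass σ (σ v) := by
      ext u
      simp only [SimpleGraph.mem_neighborFinset, Finset.mem_sdiff, mem_univ, true_and,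
        mem_colorClass, hG, SimpleGraph.comap_adj, SimpleGraph.top_adj]
      exact ne_comm
    rw [← SimpleGraph.card_neighborFinset_eq_degree, h1,
      cast_card_sdiff (subset_univ _)]
    simp
  have h := G.sum_degrees_eq_twice_card_edges
  rw [hedge] at h
  have h' : ∑ v, (G.degree v : ℝ) = 2 * #(bichrom σ) := by exact_mod_cast h
  rw [← h']
  simp only [hdeg, sum_sub_distrib, sum_const, card_univ, Fintype.card_fin, nsmul_eq_mul]
  have h2 : ∑ v, (#(colorClass σ (σ v)) : ℝ) = ∑ j, (#(colorClass σ j) : ℝ) ^ 2 := by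
    rw [← sum_fiberwise_of_maps_to (g := σ) (t := univ) (fun _ _ => mem_univ _)]
    refine sum_congr rfl fun j _ => ?_
    rw [sum_congr rfl (g := fun _ => (#(colorClass σ j) : ℝ))
      (fun v hv => by rw [(mem_filter.1 hv).2])]
    rw [sum_const, nsmul_eq_mul, sq]; rfl
  rw [h2]; ring

/-- The squared deviation of the color class sizes from their mean. -/
noncomputable def imbalance (σ : Fin n → Fin k) : ℝ :=
  ∑ j, ((#(colorClass σ j) : ℝ) - n / k) ^ 2

theorem imbalance_nonneg (σ : Fin n → Fin k) : 0 ≤ imbalance σ :=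
  sum_nonneg fun _ _ => sq_nonneg _

theorem sum_card_colorClass_sq (hk : 0 < k) (σ : Fin n → Fin k) :
    ∑ j, (#(colorClass σ j) : ℝ) ^ 2 = n ^ 2 / k + imbalance σ := by
  have h : ∑ j, (#(colorClass σ j) : ℝ) = n := by exact_mod_cast sum_card_colorClass σ
  have hk' : (k : ℝ) ≠ 0 := by positivity
  have h2 : imbalance σ = ∑ j, ((#(colorClass σ j) : ℝ) ^ 2 -
      2 * (n / k) * #(colorClass σ j) + (n / k) ^ 2) :=
    sum_congr rfl fun _ _ => by ring
  rw [h2, sum_add_distrib, sum_sub_distrib, ← mul_sum, h]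
  simp only [sum_const, card_univ, Fintype.card_fin, nsmul_eq_mul]
  field_simp
  ring

theorem one_sub_le_exp_neg_sub_sq {a : ℝ} (h0 : 0 ≤ a) (h1 : a < 1) :
    1 - a ≤ Real.exp (-(a + a ^ 2 / 2)) := by
  have h := Real.hasSum_pow_div_log_of_abs_lt_one (x := a) (by rwa [abs_of_nonneg h0])
  have h2 := sum_le_hasSum (range 2) (fun i _ => by positivity) h
  norm_num [sum_range_succ] at h2
  rw [← Real.log_le_iff_le_exp (by linarith)]
  linarith

/-- The set of all pairs of distinct vertices. -/
def allPairs (n : ℕ) : Finset (Sym2 (Fin n)) := univ.filter (fun e => ¬ e.IsDiag)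

theorem card_allPairs : #(allPairs n) = n.choose 2 := by
  have := Sym2.card_subtype_not_diag (α := Fin n)
  rw [Fintype.card_fin, Fintype.card_subtype] at this
  rw [allPairs, ← this]

theorem bichrom_subset_allPairs (σ : Fin n → Fin k) : bichrom σ ⊆ allPairs n := by
  intro e
  simp only [bichrom, allPairs, mem_filter, mem_univ, true_and]
  intro h h'
  exact h (by
    induction e with
    | h a b => simpa using congrArg σ (by simpa using h'))

theorem one_sub_mul_one_add_pow_le {n m : ℕ} {d a : ℝ} (hn : 2 ≤ n) (hd : 0 < d)
    (hmlo : d * n / 2 ≤ m) (hmhi : (m : ℝ) ≤ d * n / 2 + 1) (ha0 : 0 ≤ a) (ha1 : a < 1) :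
    ((1 - a) * (1 + 1 / ((n : ℝ) - 1))) ^ m ≤
      Real.exp (d + 1) * Real.exp (-(d * n / 2 * (a + a ^ 2 / 2))) := by
  have hn' : (2 : ℝ) ≤ n := by exact_mod_cast hn
  rw [mul_pow, mul_comm]
  have h1 : (1 + 1 / ((n : ℝ) - 1)) ^ m ≤ Real.exp (d + 1) := by
    have h11 : 1 + 1 / ((n : ℝ) - 1) ≤ Real.exp (1 / (n - 1)) := by
      have := Real.add_one_le_exp (1 / ((n : ℝ) - 1)); linarith
    have h12 : 0 ≤ 1 / ((n : ℝ) - 1) := div_nonneg zero_le_one (by linarith)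
    refine (pow_le_pow_left₀ (by linarith) h11 _).trans ?_
    rw [← Real.exp_nat_mul, Real.exp_le_exp, mul_one_div, div_le_iff₀ (by linarith)]
    have := mul_nonneg hd.le (by linarith : 0 ≤ (n : ℝ) / 2 - 1)
    linarith
  have h2 : (1 - a) ^ m ≤ Real.exp (-(d * n / 2 * (a + a ^ 2 / 2))) := by
    refine (pow_le_pow_left₀ (by linarith) (one_sub_le_exp_neg_sub_sq ha0 ha1) _).trans ?_
    rw [← Real.exp_nat_mul, Real.exp_le_exp, mul_neg, neg_le_neg_iff]
    exact mul_le_mul_of_nonneg_right hmlo (by positivity)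
  exact mul_le_mul h1 h2 (pow_nonneg (by linarith) _) (Real.exp_nonneg _)

theorem first_moment_exponent_le {k L d y : ℝ} (hk : 0 < k) (hy : 0 ≤ y) (hd0 : 0 < d)
    (hd : 2 * k * L - L - 4 ≤ d) (hdk : k * L ≤ d) (hkL : L / 4 + 1 ≤ k) :
    L - d / 2 * (1 / k + y + (1 / k + y) ^ 2 / 2) ≤ 3 / k - k * L * y / 2 := by
  have hk1 : 0 < 1 / k := by positivity
  have hsq : (1 / k) ^ 2 ≤ (1 / k + y) ^ 2 := pow_le_pow_left₀ hk1.le (by linarith) 2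
  have h3 : d / 2 * (1 / k + y + (1 / k) ^ 2 / 2) ≤ d / 2 * (1 / k + y + (1 / k + y) ^ 2 / 2) :=
    mul_le_mul_of_nonneg_left (by linarith) (by positivity)
  have h4 : k * L / 2 * y ≤ d / 2 * y :=
    mul_le_mul_of_nonneg_right (by linarith) hy
  have h5 : (k * L - L / 2 - 2) * (1 / k + (1 / k) ^ 2 / 2) ≤ d / 2 * (1 / k + (1 / k) ^ 2 / 2) :=
    mul_le_mul_of_nonneg_right (by linarith) (by positivity)
  have h6 : (k * L - L / 2 - 2) * (1 / k + (1 / k) ^ 2 / 2) =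
      L - 2 / k - (L / 4 + 1) / k / k := by
    field_simp; ring
  have h7 : (L / 4 + 1) / k / k ≤ 1 / k := by
    refine div_le_div_of_nonneg_right ?_ hk.le
    rw [div_le_one hk]; exact hkL
  have h8 : 3 / k = 2 / k + 1 / k := by ring
  rw [h8]
  linarith

theorem card_bichrom_eq (hn : 0 < n) (hk : 0 < k) (σ : Fin n → Fin k) :
    (#(bichrom σ) : ℝ) = n ^ 2 * (1 - (1 / k + imbalance σ / n ^ 2)) / 2 := by
  have hQ2 := two_mul_card_bichrom σ
  rw [sum_card_colorClass_sq hk] at hQ2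
  have hn' : (n : ℝ) ≠ 0 := by positivity
  have h : (n : ℝ) ^ 2 * (imbalance σ / n ^ 2) = imbalance σ := by field_simp
  linear_combination (1 / 2 : ℝ) * hQ2 + (1 / 2 : ℝ) * h

theorem choose_card_bichrom_mul_le {d : ℝ} (hn : 2 ≤ n) (hk : 0 < k) (hd0 : 0 < d)
    (hd : 2 * k * Real.log k - Real.log k - 4 ≤ d) (hdk : k * Real.log k ≤ d)
    (hkL : Real.log k / 4 + 1 ≤ k) (σ : Fin n → Fin k) :
    ((#(bichrom σ)).choose ⌈d * n / 2⌉₊ : ℝ) * (k : ℝ) ^ n ≤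
      (#(allPairs n)).choose ⌈d * n / 2⌉₊ * (Real.exp (d + 1) *
        Real.exp (3 * n / k - k * Real.log k * imbalance σ / (2 * n))) := by
  have hk' : (0 : ℝ) < k := by exact_mod_cast hk
  have hn' : (2 : ℝ) ≤ n := by exact_mod_cast hn
  have hmlo : d * n / 2 ≤ ⌈d * n / 2⌉₊ := Nat.le_ceil _
  have hmhi : (⌈d * n / 2⌉₊ : ℝ) ≤ d * n / 2 + 1 := (Nat.ceil_lt_add_one (by positivity)).le
  have hmpos : 0 < ⌈d * n / 2⌉₊ := Nat.ceil_pos.2 (by positivity)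
  generalize ⌈d * n / 2⌉₊ = m at *
  have hQN := card_le_card (bichrom_subset_allPairs σ)
  have hN2 : (#(allPairs n) : ℝ) = n * (n - 1) / 2 := by
    rw [card_allPairs, Nat.cast_choose_two]
  have hy0 : 0 ≤ imbalance σ / n ^ 2 := div_nonneg (imbalance_nonneg σ) (by positivity)
  have hQ := card_bichrom_eq (by omega) hk σ
  have hy : k * Real.log k * imbalance σ / (2 * n) =
      n * (k * Real.log k * (imbalance σ / n ^ 2) / 2) := by field_simp
  rw [hy]
  generalize imbalance σ / n ^ 2 = y at *
  generalize #(bichrom σ) = Q at *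
  generalize #(allPairs n) = N at *
  rcases Nat.eq_zero_or_pos Q with hQ0 | hQpos
  · rw [hQ0, Nat.choose_eq_zero_of_lt hmpos]
    simp only [Nat.cast_zero, zero_mul]
    positivity
  have hNpos : (0 : ℝ) < N := by exact_mod_cast hQpos.trans_le hQN
  have ha1 : 1 / k + y < 1 := by
    have : (0 : ℝ) < Q := by exact_mod_cast hQpos
    rw [hQ] at this
    have := pos_of_mul_pos_right (pos_of_mul_pos_left (by simpa [div_eq_mul_inv] using this)
      (by norm_num : (0 : ℝ) ≤ 2⁻¹)) (sq_nonneg (n : ℝ))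
    simp only [one_div]
    linarith
  have hch : (Q.choose m : ℝ) ≤ N.choose m * (Q / N) ^ m := by
    rw [div_pow, ← mul_div_assoc, le_div_iff₀ (by positivity)]
    exact_mod_cast choose_mul_pow_le_choose_mul_pow hQN m
  have hratio : (Q : ℝ) / N = (1 - (1 / k + y)) * (1 + 1 / (n - 1)) := by
    have : (n : ℝ) - 1 ≠ 0 := by linarith
    have : (n : ℝ) ≠ 0 := by linarith
    have h1 : 1 + 1 / ((n : ℝ) - 1) = n / (n - 1) := by field_simp; ring
    rw [h1, hQ, hN2]
    generalize 1 - (1 / (k : ℝ) + y) = b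
    field_simp
  have hpow := one_sub_mul_one_add_pow_le hn hd0 hmlo hmhi (by positivity) ha1
  rw [hratio] at hch
  have hkn : (k : ℝ) ^ n = Real.exp (n * Real.log k) := by
    rw [Real.exp_nat_mul, Real.exp_log hk']
  have hexp := mul_le_mul_of_nonneg_left
    (first_moment_exponent_le hk' hy0 hd0 hd hdk hkL) (by linarith : (0 : ℝ) ≤ n)
  calc (Q.choose m : ℝ) * (k : ℝ) ^ n
      ≤ (N.choose m * (Real.exp (d + 1) *
          Real.exp (-(d * n / 2 * (1 / k + y + (1 / k + y) ^ 2 / 2))))) *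
            Real.exp (n * Real.log k) := by
        rw [hkn]
        exact mul_le_mul_of_nonneg_right (hch.trans
          (mul_le_mul_of_nonneg_left hpow (by positivity))) (by positivity)
    _ = N.choose m * (Real.exp (d + 1) *
          Real.exp (-(d * n / 2 * (1 / k + y + (1 / k + y) ^ 2 / 2)) + n * Real.log k)) := by
        rw [Real.exp_add (-_)]; ring
    _ ≤ _ := by
        refine mul_le_mul_of_nonneg_left (mul_le_mul_of_nonneg_left ?_ (by positivity))
          (by positivity)
        rw [Real.exp_le_exp]
        have : (3 : ℝ) * n / k = n * (3 / k) := by ring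
        rw [this]
        linarith

/-- The numerical conditions on the number of colors under which the whitening is controlled. -/
structure IsLarge (k : ℕ) : Prop where
  le_log : 10 ^ 6 ≤ Real.log k
  le_log_log : 120000 ≤ Real.log (Real.log k)
  exp_le : 8 * Real.log k ^ 3 * Real.exp (-(0.7 * Real.log k)) ≤ 1

theorem eventually_isLarge : ∀ᶠ k : ℕ in atTop, IsLarge k := by
  have h1 : Tendsto (fun k : ℕ => Real.log k) atTop atTop :=
    Real.tendsto_log_atTop.comp tendsto_natCast_atTop_atTop
  have h2 : Tendsto (fun x : ℝ => 8 * x ^ 3 * Real.exp (-(0.7 * x))) atTop (nhds 0) := by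
    have h := (Real.tendsto_pow_mul_exp_neg_atTop_nhds_zero 3).comp
      (tendsto_id.const_mul_atTop (by norm_num : (0 : ℝ) < 0.7))
    have h' := h.const_mul (8 / 0.7 ^ 3)
    rw [mul_zero] at h'
    refine h'.congr fun x => ?_
    simp only [Function.comp, id]
    ring
  filter_upwards [h1.eventually_ge_atTop (10 ^ 6),
    (Real.tendsto_log_atTop.comp h1).eventually_ge_atTop 120000,
    (h2.comp h1).eventually_le_const one_pos] with k a b c using ⟨a, b, c⟩

theorem IsLarge.pos (hk : IsLarge k) : 0 < k := by
  rcases Nat.eq_zero_or_pos k with rfl | h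
  · have := hk.le_log; norm_num at this
  · exact h

theorem IsLarge.log_le (hk : IsLarge k) : Real.log k + 1 ≤ k := by
  have := Real.log_le_sub_one_of_pos (Nat.cast_pos.2 hk.pos : (0 : ℝ) < k)
  linarith

theorem IsLarge.le_sqrt (hk : IsLarge k) : 1000 ≤ √(Real.log k) :=
  Real.le_sqrt_of_sq_le (by have := hk.le_log; norm_num at this ⊢; exact this)

theorem IsLarge.inv_sqrt_le (hk : IsLarge k) : (√(Real.log k))⁻¹ ≤ 1 / 1000 := by
  rw [inv_le_comm₀ (by linarith [hk.le_sqrt]) (by norm_num)]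
  have := hk.le_sqrt
  norm_num at this ⊢; exact this

theorem IsLarge.sq_sqrt (hk : IsLarge k) : √(Real.log k) * √(Real.log k) = Real.log k :=
  Real.mul_self_sqrt (by linarith [hk.le_log])

theorem IsLarge.exp_neg_log (hk : IsLarge k) : (n : ℝ) * Real.exp (-Real.log k) = n / k := by
  rw [Real.exp_neg, Real.exp_log (Nat.cast_pos.2 hk.pos), div_eq_mul_inv]

/-- The number of neighbors in a color class at which a vertex stops being sparse. -/
noncomputable def degreeThreshold (k : ℕ) : ℕ := ⌊Real.log k / 1000⌋₊

/-- The scale `n / (k √(ln k))` of the fluctuations of the whitening in a single color class. -/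
noncomputable def fluctuation (n k : ℕ) : ℝ := (√(Real.log k))⁻¹ * (n / k)

/-- The size of the sets of vertices spanning many edges that have to be excluded. -/
noncomputable def spreadSize (n k : ℕ) : ℕ := ⌊fluctuation n k / 100⌋₊

/-- The maximal number of sparse vertices of one color. -/
noncomputable def blockSize (n k : ℕ) : ℕ := ⌈fluctuation n k⌉₊

/-- The maximal number of sparse vertices with a color in `I`. -/
noncomputable def blockWeight (σ : Fin n → Fin k) (I : Finset (Fin k)) : ℝ :=
  max (fluctuation n k)
    (#(univ.filter (fun v => σ v ∈ I)) * Real.exp (-(0.7 * Real.log k)))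

/-- The graph `E` has an exceptional substructure relative to the coloring `σ`. -/
def IsAtypical (E : Finset (Sym2 (Fin n))) (σ : Fin n → Fin k) : Prop :=
  HasSparseBlock E σ (degreeThreshold k) (spreadSize n k) (blockSize n k) (blockWeight σ) ∨
    HasDenseSpread E σ (degreeThreshold k) (spreadSize n k) (blockSize n k)

/-- The color classes of `σ` have almost equal sizes. -/
def IsBalanced (σ : Fin n → Fin k) : Prop :=
  imbalance σ ≤ 8 * (n / k : ℝ) ^ 2 / Real.log k

/-- The error bound for the sizes of the color classes of the whitening. -/
noncomputable def whiteningError (k : ℕ) : ℝ := 5 / √(Real.log k) + 1 / (k + 1)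

theorem whiteningError_pos (k : ℕ) : 0 < whiteningError k := by
  unfold whiteningError; positivity

theorem tendsto_whiteningError : Tendsto whiteningError atTop (nhds 0) := by
  have h1 : Tendsto (fun k : ℕ => √(Real.log k)) atTop atTop :=
    Real.tendsto_sqrt_atTop.comp (Real.tendsto_log_atTop.comp tendsto_natCast_atTop_atTop)
  have h := (h1.const_div_atTop 5).add (tendsto_one_div_add_atTop_nhds_zero_nat (𝕜 := ℝ))
  rwa [add_zero] at h

/-- The three conclusions about the whitening of `σ`. -/
def HasTypicalWhitening (E : Finset (Sym2 (Fin n))) (σ : Fin n → Fin k) : Prop :=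
  ((Nat.card {v : Fin n // v ∉ whiteSet E σ} : ℝ) ≤ n * (k : ℝ) ^ (-(2 : ℝ) / 3)) ∧
  (∀ i : Fin k, |(Nat.card {v : Fin n // v ∈ whiteSet E σ ∧ σ v = i} : ℝ) - n / k| ≤
    whiteningError k * n / k) ∧
  ((Nat.card {i : Fin k // n / (k * Real.log k ^ (3 : ℕ)) <
      |(Nat.card {v : Fin n // v ∈ whiteSet E σ ∧ σ v = i} : ℝ) - n / k|} : ℝ)
    ≤ Real.log k ^ (9 : ℕ))

theorem IsBalanced.abs_sub_le {σ : Fin n → Fin k} (h : IsBalanced σ) (hk : IsLarge k)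
    (j : Fin k) : |(#(colorClass σ j) : ℝ) - n / k| ≤ 3 * fluctuation n k := by
  have h1 : ((#(colorClass σ j) : ℝ) - n / k) ^ 2 ≤ imbalance σ :=
    single_le_sum (f := fun j => ((#(colorClass σ j) : ℝ) - n / k) ^ 2)
      (fun _ _ => sq_nonneg _) (mem_univ j)
  have h0 : 0 ≤ fluctuation n k := by unfold fluctuation; positivity
  refine abs_le_of_sq_le_sq (h1.trans (h.trans ?_)) (by positivity)
  have hL : Real.log k = √(Real.log k) ^ 2 := by rw [sq, hk.sq_sqrt]
  have := hk.le_sqrt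
  have h3 : 8 * (n / k : ℝ) ^ 2 / Real.log k = 8 * fluctuation n k ^ 2 := by
    rw [hL, fluctuation, mul_pow, inv_pow]
    rw [← hL]; ring
  rw [h3]
  nlinarith [sq_nonneg (fluctuation n k)]

theorem fluctuation_le (hk : IsLarge k) : fluctuation n k ≤ n / k / 1000 := by
  have := mul_le_mul_of_nonneg_right hk.inv_sqrt_le (by positivity : (0 : ℝ) ≤ n / k)
  unfold fluctuation; linarith

theorem fluctuation_nonneg : 0 ≤ fluctuation n k := by unfold fluctuation; positivity

theorem blockWeight_singleton_le {σ : Fin n → Fin k} (h : IsBalanced σ) (hk : IsLarge k)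
    (j : Fin k) : blockWeight σ {j} ≤ blockSize n k := by
  refine le_trans ?_ (Nat.le_ceil _)
  refine max_le le_rfl ?_
  have h1 : univ.filter (fun v => σ v ∈ ({j} : Finset (Fin k))) = colorClass σ j := by
    simp [colorClass]
  rw [h1]
  have h2 := (abs_le.1 (h.abs_sub_le hk j)).2
  have h3 := fluctuation_le (n := n) hk
  have hL := hk.le_log
  have h4 : 2 * Real.exp (-(0.7 * Real.log k)) ≤ (√(Real.log k))⁻¹ := by
    rw [← one_div, le_div_iff₀ (by linarith [hk.le_sqrt])]
    refine le_trans ?_ hk.exp_le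
    have h5 : 2 * √(Real.log k) ≤ 8 * Real.log k ^ 3 := by
      have h6 : √(Real.log k) ≤ Real.log k := by nlinarith [hk.sq_sqrt, hk.le_sqrt]
      have h7 : Real.log k ^ 1 ≤ Real.log k ^ 3 :=
        pow_le_pow_right₀ (by linarith) (by norm_num)
      linarith
    have := mul_le_mul_of_nonneg_right h5 (Real.exp_nonneg (-(0.7 * Real.log k)))
    linarith
  have h0 : (0 : ℝ) ≤ n / k := by positivity
  calc (#(colorClass σ j) : ℝ) * Real.exp (-(0.7 * Real.log k))
      ≤ (2 * (n / k)) * Real.exp (-(0.7 * Real.log k)) :=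
        mul_le_mul_of_nonneg_right (by linarith) (Real.exp_nonneg _)
    _ = (2 * Real.exp (-(0.7 * Real.log k))) * (n / k) := by ring
    _ ≤ _ := mul_le_mul_of_nonneg_right h4 h0

theorem card_mul_le_of_forall_lt {ι : Type*} {I : Finset ι} {f : ι → ℝ} {c b : ℝ}
    (h : ∀ i ∈ I, c < f i) (hb : ∑ i ∈ I, f i ≤ b) : #I * c ≤ b := by
  have := card_nsmul_le_sum I f c fun i hi => (h i hi).le
  rw [nsmul_eq_mul] at this
  linarith

theorem card_filter_deviation_le {σ : Fin n → Fin k} (h : IsBalanced σ) (hk : IsLarge k)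
    (hn : 0 < n) : (#(univ.filter (fun i => n / k / (2 * Real.log k ^ 3) <
      |(#(colorClass σ i) : ℝ) - n / k|)) : ℝ) ≤ 32 * Real.log k ^ 5 := by
  have hL := hk.le_log
  have hk0 := hk.pos
  have hu : (0 : ℝ) < n / k := by positivity
  have h1 := card_mul_le_of_forall_lt
    (I := univ.filter (fun i => n / k / (2 * Real.log k ^ 3) <
      |(#(colorClass σ i) : ℝ) - n / k|))
    (f := fun i => ((#(colorClass σ i) : ℝ) - n / k) ^ 2)
    (c := (n / k / (2 * Real.log k ^ 3)) ^ 2) (b := 8 * (n / k : ℝ) ^ 2 / Real.log k)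
    (fun i hi => by
      rw [← sq_abs ((#(colorClass σ i) : ℝ) - n / k)]
      exact pow_lt_pow_left₀ (mem_filter.1 hi).2 (by positivity) (by norm_num))
    ((sum_le_sum_of_subset_of_nonneg (subset_univ _) fun _ _ _ => sq_nonneg _).trans h)
  have hpos : (0 : ℝ) < (n / k / (2 * Real.log k ^ 3)) ^ 2 := by positivity
  refine le_of_mul_le_mul_right (h1.trans_eq ?_) hpos
  have : Real.log k ≠ 0 := by linarith
  have : (n / k : ℝ) ≠ 0 := hu.ne'
  generalize (n / k : ℝ) = u at *
  field_simp
  ring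

theorem card_filter_mem_eq_sum (σ : Fin n → Fin k) (U : Finset (Fin n)) (I : Finset (Fin k)) :
    #(U.filter (fun v => σ v ∈ I)) = ∑ i ∈ I, #(U ∩ colorClass σ i) := by
  have h : U.filter (fun v => σ v ∈ I) = I.biUnion fun i => U ∩ colorClass σ i := by
    ext v
    simp only [mem_filter, mem_biUnion, mem_inter, mem_colorClass]
    exact ⟨fun h => ⟨_, h.2, h.1, rfl⟩, fun ⟨i, hi, hv, h⟩ => ⟨hv, h ▸ hi⟩⟩
  rw [h, card_biUnion]
  intro i _ j _ hij
  refine disjoint_left.2 fun v hv hv' => hij ?_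
  rw [← mem_colorClass.1 (mem_inter.1 hv).2, mem_colorClass.1 (mem_inter.1 hv').2]

theorem card_filter_inter_le {σ : Fin n → Fin k} (U : Finset (Fin n)) (c b : ℝ)
    (hb : #(U.filter (fun v => σ v ∈ univ.filter fun i => c < #(U ∩ colorClass σ i))) ≤ b) :
    #(univ.filter fun i => c < #(U ∩ colorClass σ i)) * c ≤ b := by
  refine card_mul_le_of_forall_lt (f := fun i => (#(U ∩ colorClass σ i) : ℝ))
    (fun i hi => (mem_filter.1 hi).2) (le_trans (le_of_eq ?_) hb)
  rw [card_filter_mem_eq_sum, Nat.cast_sum]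

theorem card_filter_sparse_le {σ : Fin n → Fin k}
    (h : IsBalanced σ) (hk : IsLarge k) (hn : 0 < n) {U : Finset (Fin n)}
    (hU : ∀ I : Finset (Fin k), (#(U.filter (fun v => σ v ∈ I)) : ℝ) < blockWeight σ I) :
    (#(univ.filter fun i => n / k / (4 * Real.log k ^ 3) < #(U ∩ colorClass σ i)) : ℝ) ≤
      4 * Real.log k ^ 3 := by
  have hL := hk.le_log
  have hk0 := hk.pos
  have hu : (0 : ℝ) < n / k := by positivity
  set I := univ.filter fun i => n / k / (4 * Real.log k ^ 3) < #(U ∩ colorClass σ i) with hI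
  have h1 := card_filter_inter_le U (n / k / (4 * Real.log k ^ 3)) _ le_rfl (σ := σ)
  rw [← hI] at h1
  have h2 := h1.trans_lt (hU I)
  rcases lt_max_iff.1 h2 with h3 | h3
  · have hf := fluctuation_le (n := n) hk
    have h4 : #I * (n / k / (4 * Real.log k ^ 3)) ≤
        4 * Real.log k ^ 3 * (n / k / (4 * Real.log k ^ 3)) := by
      have : 4 * Real.log k ^ 3 * (n / k / (4 * Real.log k ^ 3)) = n / k := by
        have : Real.log k ≠ 0 := by linarith
        field_simp
      rw [this]; linarith
    exact le_of_mul_le_mul_right h4 (by positivity)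
  · exfalso
    have h4 : (#(univ.filter (fun v => σ v ∈ I)) : ℝ) ≤ #I * (2 * (n / k)) := by
      rw [card_filter_mem_eq_sum, Nat.cast_sum, ← nsmul_eq_mul]
      refine sum_le_card_nsmul _ _ _ fun i _ => ?_
      have h5 := (abs_le.1 (h.abs_sub_le hk i)).2
      have h6 := fluctuation_le (n := n) hk
      rw [univ_inter]
      linarith
    have h5 := mul_le_mul_of_nonneg_right h4 (Real.exp_nonneg (-(0.7 * Real.log k)))
    have h6 : (2 * (n / k)) * Real.exp (-(0.7 * Real.log k)) ≤
        n / k / (4 * Real.log k ^ 3) := by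
      rw [le_div_iff₀ (by positivity)]
      have := mul_le_mul_of_nonneg_right hk.exp_le hu.le
      linarith
    have h7 := mul_le_mul_of_nonneg_left h6 (Nat.cast_nonneg (α := ℝ) #I)
    linarith

theorem hasTypicalWhitening_of_not_isAtypical {E : Finset (Sym2 (Fin n))} {σ : Fin n → Fin k}
    (hk : IsLarge k) (hn : k * (k + 1) ≤ n) (hbal : IsBalanced σ) (h : ¬ IsAtypical E σ) :
    HasTypicalWhitening E σ := by
  obtain ⟨h1, h2⟩ := not_or.1 h
  have hz := fun j => blockWeight_singleton_le hbal hk j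
  obtain ⟨X, hX, hw⟩ := exists_card_le_forall_notMem_whiteSet h1 hz h2
  have hUj := card_sparseSet_inter_lt h1 hz (X := ∅) (by simp)
  have hUI := card_sparseSet_filter_lt h1 hz
  generalize sparseSet E σ (degreeThreshold k) ∅ = U at *
  clear h1 h2 h
  have hL := hk.le_log
  have hk0 := hk.pos
  have hn0 : 0 < n := lt_of_lt_of_le (by positivity) hn
  have hu : (0 : ℝ) < n / k := by positivity
  have hf := fluctuation_le (n := n) hk
  have hf0 := fluctuation_nonneg (n := n) (k := k)
  have hXf : (#X : ℝ) ≤ fluctuation n k / 100 :=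
    (Nat.cast_le.2 hX).trans (Nat.floor_le (by positivity))
  have hloss : ∀ i, (#(colorClass σ i) : ℝ) ≤
      Nat.card {v : Fin n // v ∈ whiteSet E σ ∧ σ v = i} +
        (#(U ∩ colorClass σ i) + #(X ∩ colorClass σ i)) ∧
      (Nat.card {v : Fin n // v ∈ whiteSet E σ ∧ σ v = i} : ℝ) ≤ #(colorClass σ i) := by
    intro i
    rw [Nat.card_eq_fintype_card, Fintype.card_subtype]
    constructor
    · have hsub : colorClass σ i ⊆ univ.filter (fun v => v ∈ whiteSet E σ ∧ σ v = i) ∪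
          (U ∩ colorClass σ i ∪ X ∩ colorClass σ i) := by
        intro v hv
        rw [mem_colorClass] at hv
        have := hw v
        simp only [mem_union, mem_inter, mem_filter, mem_univ, true_and, mem_colorClass,
          hv, and_true] at this ⊢
        tauto
      have h5 := (card_le_card hsub).trans ((card_union_le _ _).trans
        (Nat.add_le_add_left (card_union_le _ _) _))
      exact_mod_cast h5
    · refine Nat.cast_le.2 (card_le_card fun v hv => ?_)
      rw [mem_colorClass]
      exact (mem_filter.1 hv).2.2
  refine ⟨?_, fun i => ?_, ?_⟩
  · have h3 : (Nat.card {v : Fin n // v ∉ whiteSet E σ} : ℝ) ≤ #U + #X := by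
      rw [Nat.card_eq_fintype_card, Fintype.card_subtype]
      exact_mod_cast (card_le_card fun v hv => hw v (mem_filter.1 hv).2).trans
        (card_union_le _ _)
    have h4 := hUI univ
    simp only [mem_univ, filter_true] at h4
    rw [blockWeight] at h4
    simp only [mem_univ, filter_true, card_univ, Fintype.card_fin] at h4
    have hkr : (k : ℝ) ^ (-(2 : ℝ) / 3) = Real.exp (Real.log k * (-2 / 3)) :=
      Real.rpow_def_of_pos (by positivity) _
    have he : 2 * Real.exp (-(0.7 * Real.log k)) ≤ Real.exp (Real.log k * (-2 / 3)) := by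
      have h5 := Real.add_one_le_exp (Real.log k / 30)
      have h6 : Real.exp (Real.log k * (-2 / 3)) =
          Real.exp (Real.log k / 30) * Real.exp (-(0.7 * Real.log k)) := by
        rw [← Real.exp_add]; congr 1; ring
      rw [h6]
      exact mul_le_mul_of_nonneg_right (by linarith) (Real.exp_nonneg _)
    have he' : (n / k : ℝ) ≤ n * Real.exp (-(0.7 * Real.log k)) := by
      rw [← hk.exp_neg_log]
      exact mul_le_mul_of_nonneg_left (Real.exp_le_exp.2 (by linarith)) (by positivity)
    have h7 := mul_le_mul_of_nonneg_left he (Nat.cast_nonneg (α := ℝ) n)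
    rw [hkr]
    have h8 : max (fluctuation n k) (n * Real.exp (-(0.7 * Real.log k))) ≤
        n * Real.exp (-(0.7 * Real.log k)) := max_le (by linarith) le_rfl
    linarith
  · have h3 := abs_le.1 (hbal.abs_sub_le hk i)
    have h4 : (#(U ∩ colorClass σ i) : ℝ) ≤ fluctuation n k + 1 :=
      (Nat.cast_le.2 (hUj i).le).trans (Nat.ceil_lt_add_one hf0).le
    have h5 : (#(X ∩ colorClass σ i) : ℝ) ≤ #X := Nat.cast_le.2 (card_le_card inter_subset_left)
    have h6 : (1 : ℝ) ≤ n / k * (1 / (k + 1)) := by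
      rw [div_mul_div_comm, mul_one, one_le_div (by positivity)]
      exact_mod_cast hn
    have h7 : whiteningError k * n / k = 5 * fluctuation n k + n / k * (1 / (k + 1)) := by
      unfold whiteningError fluctuation; ring
    rw [h7, abs_le]
    have := hloss i
    constructor <;> linarith [this.1, this.2, h3.1, h3.2]
  · rw [Nat.card_eq_fintype_card, Fintype.card_subtype]
    have hA := card_filter_deviation_le hbal hk hn0
    have hB := card_filter_sparse_le hbal hk hn0 hUI
    have hC : (#(univ.filter fun i => n / k / (4 * Real.log k ^ 3) <
        #(X ∩ colorClass σ i)) : ℝ) ≤ 4 * Real.log k ^ 3 := by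
      have h5 := card_filter_inter_le X (n / k / (4 * Real.log k ^ 3)) #X
        (Nat.cast_le.2 (card_le_card (filter_subset _ _))) (σ := σ)
      refine le_of_mul_le_mul_right (h5.trans (?_ : _ ≤ 4 * Real.log k ^ 3 *
        (n / k / (4 * Real.log k ^ 3)))) (by positivity)
      have : 4 * Real.log k ^ 3 * (n / k / (4 * Real.log k ^ 3)) = n / k := by
        have : Real.log k ≠ 0 := by linarith
        field_simp
      rw [this]; linarith
    have hsub : univ.filter (fun i => (n : ℝ) / (k * Real.log k ^ (3 : ℕ)) <
        |(Nat.card {v : Fin n // v ∈ whiteSet E σ ∧ σ v = i} : ℝ) - n / k|) ⊆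
        univ.filter (fun i => n / k / (2 * Real.log k ^ 3) <
          |(#(colorClass σ i) : ℝ) - n / k|) ∪
        (univ.filter (fun i => n / k / (4 * Real.log k ^ 3) < #(U ∩ colorClass σ i)) ∪
          univ.filter (fun i => n / k / (4 * Real.log k ^ 3) < #(X ∩ colorClass σ i))) := by
      intro i hi
      by_contra hc
      simp only [mem_union, mem_filter, mem_univ, true_and, not_or, not_lt] at hc hi
      obtain ⟨c1, c2, c3⟩ := hc
      have := hloss i
      have c1' := abs_le.1 c1
      refine absurd hi (not_lt.2 ?_)
      have e1 : (n : ℝ) / (k * Real.log k ^ (3 : ℕ)) =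
          n / k / (2 * Real.log k ^ 3) + n / k / (4 * Real.log k ^ 3) +
            n / k / (4 * Real.log k ^ 3) := by
        have : Real.log k ≠ 0 := by linarith
        field_simp; norm_num
      rw [e1, abs_le]
      have : 0 < n / k / (4 * Real.log k ^ 3) := by positivity
      constructor <;> linarith [c1'.1, c1'.2, (hloss i).1, (hloss i).2]
    have hcard := (card_le_card hsub).trans ((card_union_le _ _).trans
        (Nat.add_le_add_left (card_union_le _ _) _))
    have hcard' : (#(univ.filter (fun i => (n : ℝ) / (k * Real.log k ^ (3 : ℕ)) <
        |(Nat.card {v : Fin n // v ∈ whiteSet E σ ∧ σ v = i} : ℝ) - n / k|)) : ℝ) ≤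
        32 * Real.log k ^ 5 + (4 * Real.log k ^ 3 + 4 * Real.log k ^ 3) := by
      refine le_trans (Nat.cast_le.2 hcard) ?_
      push_cast
      linarith
    refine hcard'.trans ?_
    have p1 : Real.log k ^ 3 ≤ Real.log k ^ 5 := pow_le_pow_right₀ (by linarith) (by norm_num)
    have p2 : (10 : ℝ) ^ 6 * Real.log k ^ 5 ≤ Real.log k ^ 9 := by
      have p3 : Real.log k ^ 9 = Real.log k ^ 4 * Real.log k ^ 5 := by ring
      rw [p3]
      refine mul_le_mul_of_nonneg_right ?_ (by positivity)
      exact hL.trans (le_self_pow₀ (by linarith) (by norm_num))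
    have p4 : 0 ≤ Real.log k ^ 5 := by positivity
    linarith

theorem IsBalanced.le_card_bichrom {σ : Fin n → Fin k} (h : IsBalanced σ) (hk : IsLarge k)
    (hn : 0 < n) : 0.45 * (n : ℝ) ^ 2 ≤ #(bichrom σ) := by
  have hL := hk.le_log
  have hkL := hk.log_le
  have hk1 : (1 : ℝ) / k ≤ 1 / 100 := one_div_le_one_div_of_le (by norm_num) (by linarith)
  have hk0 : (0 : ℝ) ≤ 1 / k := by positivity
  rw [card_bichrom_eq hn hk.pos]
  have hy : imbalance σ / n ^ 2 ≤ 1 / 100 := by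
    rw [div_le_iff₀ (by positivity)]
    refine h.trans ?_
    have h1 : 8 * (n / k : ℝ) ^ 2 / Real.log k = 8 * (1 / k) ^ 2 / Real.log k * n ^ 2 := by
      ring
    rw [h1]
    refine mul_le_mul_of_nonneg_right ?_ (by positivity)
    rw [div_le_iff₀ (by linarith)]
    nlinarith
  nlinarith [sq_nonneg (n : ℝ)]

theorem card_bichrom_le (σ : Fin n → Fin k) : (#(bichrom σ) : ℝ) ≤ n ^ 2 / 2 := by
  have := two_mul_card_bichrom σ
  have : 0 ≤ ∑ j, (#(colorClass σ j) : ℝ) ^ 2 := sum_nonneg fun _ _ => sq_nonneg _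
  linarith

theorem ceil_le_card_bichrom {σ : Fin n → Fin k} (h : IsBalanced σ) (hk : IsLarge k)
    (hn : 4 * k ^ 2 ≤ n) {d : ℝ} (hd : d ≤ 2 * k * Real.log k) :
    ⌈d * n / 2⌉₊ ≤ #(bichrom σ) := by
  have hk0 := hk.pos
  have hn0 : 0 < n := lt_of_lt_of_le (by positivity) hn
  have hn' : 4 * (k : ℝ) ^ 2 ≤ n := by exact_mod_cast hn
  have hkL := hk.log_le
  have hk1 : (0 : ℝ) < k := by positivity
  rw [Nat.ceil_le]
  refine le_trans ?_ (h.le_card_bichrom hk hn0)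
  have h1 : d ≤ n / 2 := by nlinarith
  nlinarith [(Nat.cast_pos.2 hn0 : (0 : ℝ) < n), sq_nonneg (n : ℝ)]

theorem le_edgeDensity_mul {σ : Fin n → Fin k} (h : IsBalanced σ) (hk : IsLarge k)
    (hn : 0 < n) {d : ℝ} (hd : 1.99 * Real.log k * k ≤ d) :
    1.99 * Real.log k ≤ (⌈d * n / 2⌉₊ / #(bichrom σ) : ℝ) * (n / k) := by
  have hk0 := hk.pos
  have hL := hk.le_log
  have hn' : (0 : ℝ) < n := Nat.cast_pos.2 hn
  have hQ : (0 : ℝ) < #(bichrom σ) :=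
    lt_of_lt_of_le (by positivity) (h.le_card_bichrom hk hn)
  rw [div_mul_div_comm, le_div_iff₀ (by positivity)]
  calc 1.99 * Real.log k * (#(bichrom σ) * k)
      = 1.99 * Real.log k * k * #(bichrom σ) := by ring
    _ ≤ d * (n ^ 2 / 2) :=
        mul_le_mul hd (card_bichrom_le σ) hQ.le (le_trans (by positivity) hd)
    _ = d * n / 2 * n := by ring
    _ ≤ _ := mul_le_mul_of_nonneg_right (Nat.le_ceil _) hn'.le

theorem edgeDensity_mul_le {σ : Fin n → Fin k} (h : IsBalanced σ) (hk : IsLarge k)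
    (hn : 0 < n) {d : ℝ} (hd0 : 0 ≤ d) (hd : d ≤ 2 * k * Real.log k) :
    (⌈d * n / 2⌉₊ / #(bichrom σ) : ℝ) * (n / k) ≤ 3 * Real.log k := by
  have hk0 := hk.pos
  have hL := hk.le_log
  have hn' : (1 : ℝ) ≤ n := Nat.one_le_cast.2 hn
  have hk1 : (1 : ℝ) ≤ k := Nat.one_le_cast.2 hk0
  have hQ := h.le_card_bichrom hk hn
  rw [div_mul_div_comm, div_le_iff₀ (mul_pos (lt_of_lt_of_le (by positivity) hQ)
    (by positivity))]
  have h1 : (⌈d * n / 2⌉₊ : ℝ) ≤ d * n / 2 + 1 := (Nat.ceil_lt_add_one (by positivity)).le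
  have h2 : (⌈d * n / 2⌉₊ : ℝ) * n ≤ (2 * k * Real.log k * n / 2 + 1) * n := by
    refine mul_le_mul_of_nonneg_right (h1.trans ?_) (by positivity)
    gcongr
  have h3 : 3 * Real.log k * (0.45 * (n : ℝ) ^ 2 * k) ≤
      3 * Real.log k * (#(bichrom σ) * k) := by gcongr
  have h4 : (n : ℝ) ≤ 0.35 * (k * Real.log k * n ^ 2) := by
    have : 1 * (10 : ℝ) ^ 6 * (n * 1) ≤ k * Real.log k * (n * n) := by gcongr
    nlinarith
  nlinarith

theorem le_blockSize_add_spreadSize {σ : Fin n → Fin k} (h : IsBalanced σ) (hk : IsLarge k)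
    (hf : 1000 ≤ fluctuation n k) (j : Fin k) :
    0.98 * (n / k : ℝ) + spreadSize n k + blockSize n k ≤ #(colorClass σ j) := by
  have h1 := (abs_le.1 (h.abs_sub_le hk j)).1
  have h2 := fluctuation_le (n := n) hk
  have h3 : (spreadSize n k : ℝ) ≤ fluctuation n k / 100 := Nat.floor_le (by linarith)
  have h4 : (blockSize n k : ℝ) ≤ fluctuation n k + 1 :=
    (Nat.ceil_lt_add_one (by linarith)).le
  linarith

theorem log_mul_fluctuation (hk : IsLarge k) :
    1000 * (n / k : ℝ) ≤ Real.log k * fluctuation n k := by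
  have h1 : Real.log k * fluctuation n k = √(Real.log k) * (n / k) := by
    have := hk.le_sqrt
    have hne : √(Real.log k) ≠ 0 := by linarith
    rw [fluctuation, ← mul_assoc]
    congr 1
    rw [mul_inv_eq_iff_eq_mul₀ hne, hk.sq_sqrt]
  rw [h1]
  exact mul_le_mul_of_nonneg_right hk.le_sqrt (by positivity)

theorem binomExp_sparse_le {σ : Fin n → Fin k} (h : IsBalanced σ) (hk : IsLarge k)
    (hf : 1000 ≤ fluctuation n k) {p : ℝ} (hp0 : 0 ≤ p) (hp1 : p ≤ 1)
    (hp : 1.99 * Real.log k ≤ p * (n / k)) :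
    binomExp p (bichrom σ) (fun E => if HasSparseBlock E σ (degreeThreshold k) (spreadSize n k)
      (blockSize n k) (blockWeight σ) then 1 else 0) ≤ 2 ^ k * Real.exp (-(4 * (n / k))) := by
  have hL := hk.le_log
  have hR : (degreeThreshold k : ℝ) ≤ Real.log k / 1000 := Nat.floor_le (by linarith)
  have hx : (spreadSize n k : ℝ) ≤ fluctuation n k / 100 := Nat.floor_le (by linarith)
  refine (binomExp_hasSparseBlock_le hp0 hp1 σ _ _ _ _ (L := Real.log k)
    (M := 0.98 * (n / k)) (a₀ := fluctuation n k) (by linarith)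
    (le_blockSize_add_spreadSize h hk hf) ?_ (fun I => le_max_left _ _)
    (fun I => le_max_right _ _)).trans ?_
  · have hk' : (k : ℝ) = Real.exp (Real.log k) :=
      (Real.exp_log (Nat.cast_pos.2 hk.pos)).symm
    have h5 : Real.exp (-5) ≤ 1 / 100 := by
      rw [Real.exp_neg, ← one_div]
      refine one_div_le_one_div_of_le (by norm_num) ?_
      have h1 := Real.exp_one_gt_d9
      have h2 : Real.exp 5 = Real.exp 1 ^ 5 := by rw [← Real.exp_nat_mul]; norm_num
      rw [h2]
      calc (100 : ℝ) ≤ 2.7 ^ 5 := by norm_num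
        _ ≤ _ := pow_le_pow_left₀ (by norm_num) (by linarith) 5
    nth_rw 1 [hk']
    rw [← Real.exp_add, ← Real.exp_add, Real.exp_le_exp]
    have h6 : p * 0.99 * (0.98 * (n / k)) ≤ p * (1 - Real.exp (-5)) * (0.98 * (n / k)) := by
      gcongr
      linarith
    linarith
  · refine mul_le_mul_of_nonneg_left ?_ (by positivity)
    rw [hk.exp_neg_log, ← Real.exp_add, Real.exp_le_exp]
    have h1 := log_mul_fluctuation (n := n) hk
    have h2 := mul_le_mul_of_nonneg_left hx (by linarith : 0 ≤ Real.log k)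
    have h3 : (0 : ℝ) ≤ n / k := by positivity
    linarith

theorem binomExp_spread_le {σ : Fin n → Fin k} (hk : IsLarge k)
    (hf : 1000 ≤ fluctuation n k) {p : ℝ} (hp0 : 0 ≤ p) (hp1 : p ≤ 1)
    (hp : p * (n / k) ≤ 3 * Real.log k) :
    binomExp p (bichrom σ) (fun E => if HasDenseSpread E σ (degreeThreshold k) (spreadSize n k)
      (blockSize n k) then 1 else 0) ≤ Real.exp (-(4 * (n / k))) := by
  have hL := hk.le_log
  have hLL := hk.le_log_log
  have hR : Real.log k / 1000 - 1 ≤ degreeThreshold k := (Nat.sub_one_lt_floor _).le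
  have hx : (spreadSize n k : ℝ) ≤ fluctuation n k / 100 := Nat.floor_le (by linarith)
  have hx' : fluctuation n k / 100 - 1 ≤ spreadSize n k := (Nat.sub_one_lt_floor _).le
  have hz : (blockSize n k : ℝ) ≤ fluctuation n k + 1 :=
    (Nat.ceil_lt_add_one (by linarith)).le
  refine (binomExp_hasDenseSpread_le hp0 hp1 σ _ _ _ (L := Real.log k)
    (s := Real.log (Real.log k) / 4) (by linarith) (by linarith) ?_).trans ?_
  · have hk' : (k : ℝ) = Real.exp (Real.log k) :=
      (Real.exp_log (Nat.cast_pos.2 hk.pos)).symm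
    have hs : Real.exp (2 * (Real.log (Real.log k) / 4)) = √(Real.log k) := by
      rw [Real.sqrt_eq_rpow, Real.rpow_def_of_pos (by linarith)]
      congr 1; ring
    rw [hs]
    nth_rw 1 [hk']
    rw [← Real.exp_add, ← Real.exp_add, Real.exp_le_exp]
    have h1 : p * √(Real.log k) * (blockSize n k + spreadSize n k) ≤ 1.02 * (3 * Real.log k) := by
      have hne : √(Real.log k) ≠ 0 := by linarith [hk.le_sqrt]
      calc p * √(Real.log k) * (blockSize n k + spreadSize n k)
          ≤ p * √(Real.log k) * (1.02 * fluctuation n k) := by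
            gcongr
            linarith
        _ = 1.02 * (p * (n / k)) := by
            rw [fluctuation]; field_simp
        _ ≤ _ := by gcongr
    have h2 : (120000 : ℝ) / 4 * (0.0005 * Real.log k) ≤
        Real.log (Real.log k) / 4 * degreeThreshold k := by
      gcongr
      linarith
    linarith
  · rw [hk.exp_neg_log, Real.exp_le_exp]
    have h1 := log_mul_fluctuation (n := n) hk
    have h2 := mul_le_mul_of_nonneg_left (by linarith : fluctuation n k / 200 ≤ spreadSize n k)
      (by linarith : 0 ≤ Real.log k)
    have h3 : (0 : ℝ) ≤ n / k := by positivity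
    linarith

theorem card_filter_isAtypical_le {σ : Fin n → Fin k} (h : IsBalanced σ) (hk : IsLarge k)
    (hn : 4 * k ^ 2 ≤ n) (hf : 1000 ≤ fluctuation n k) {d : ℝ}
    (hd : 1.99 * Real.log k * k ≤ d) (hd' : d ≤ 2 * k * Real.log k) :
    (#(((bichrom σ).powersetCard ⌈d * n / 2⌉₊).filter (fun E => IsAtypical E σ)) : ℝ) ≤
      (#(bichrom σ)).choose ⌈d * n / 2⌉₊ *
        ((n ^ 2 + 1) * ((2 ^ k + 1) * Real.exp (-(4 * (n / k))))) := by
  have hk0 := hk.pos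
  have hL := hk.le_log
  have hn0 : 0 < n := lt_of_lt_of_le (by positivity) hn
  have hd0 : 0 ≤ d := le_trans (by positivity) hd
  have hm := ceil_le_card_bichrom h hk hn hd'
  have hQ0 : (0 : ℝ) < #(bichrom σ) :=
    lt_of_lt_of_le (by positivity) (h.le_card_bichrom hk hn0)
  refine (card_filter_powersetCard_le hm (Nat.cast_pos.1 hQ0) _).trans ?_
  have hlo := le_edgeDensity_mul h hk hn0 hd
  have hhi := edgeDensity_mul_le h hk hn0 hd0 hd'
  have hp0 : (0 : ℝ) ≤ ⌈d * n / 2⌉₊ / #(bichrom σ) := by positivity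
  have hp1 : (⌈d * n / 2⌉₊ / #(bichrom σ) : ℝ) ≤ 1 :=
    div_le_one_of_le₀ (Nat.cast_le.2 hm) hQ0.le
  generalize (⌈d * n / 2⌉₊ / #(bichrom σ) : ℝ) = p at *
  refine mul_le_mul_of_nonneg_left ?_ (Nat.cast_nonneg _)
  have hQ : (#(bichrom σ) : ℝ) ≤ n ^ 2 := (card_bichrom_le σ).trans (by
    have := sq_nonneg (n : ℝ); linarith)
  refine mul_le_mul (by linarith) ?_ ?_ (by positivity)
  · have h1 : binomExp p (bichrom σ) (fun E => if IsAtypical E σ then 1 else 0) ≤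
        binomExp p (bichrom σ) (fun E =>
          (if HasSparseBlock E σ (degreeThreshold k) (spreadSize n k) (blockSize n k)
            (blockWeight σ) then (1 : ℝ) else 0) +
          (if HasDenseSpread E σ (degreeThreshold k) (spreadSize n k) (blockSize n k)
            then (1 : ℝ) else 0)) := by
      refine binomExp_mono hp0 hp1 fun E _ => ?_
      unfold IsAtypical
      split_ifs <;> first | (exfalso; tauto) | norm_num
    refine h1.trans ?_
    have h2 := binomExp_sparse_le h hk hf hp0 hp1 hlo
    have h3 := binomExp_spread_le (σ := σ) hk hf hp0 hp1 hhi
    simp only [binomExp, mul_add, sum_add_distrib] at h2 h3 ⊢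
    linarith
  · exact sum_nonneg fun E _ => mul_nonneg (mul_nonneg (pow_nonneg hp0 _)
      (pow_nonneg (by linarith) _)) (by dsimp only; split_ifs <;> norm_num)

theorem IsLarge.degree_bound (hk : IsLarge k) {d : ℝ}
    (hd : 2 * k * Real.log k - Real.log k - 4 ≤ d) : 1.99 * Real.log k * k ≤ d := by
  have hL := hk.le_log
  have hkL := hk.log_le
  nlinarith

theorem card_filter_not_hasTypicalWhitening_mul_le (hk : IsLarge k) {d : ℝ}
    (hd : 2 * k * Real.log k - Real.log k - 4 ≤ d) (hd' : d ≤ 2 * k * Real.log k)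
    (hn : 4 * k ^ 2 ≤ n) (hf : 1000 ≤ fluctuation n k) (σ : Fin n → Fin k) :
    (#(((bichrom σ).powersetCard ⌈d * n / 2⌉₊).filter
      (fun E => ¬ HasTypicalWhitening E σ)) : ℝ) * (k : ℝ) ^ n ≤
      (#(allPairs n)).choose ⌈d * n / 2⌉₊ *
        (Real.exp (d + 1) * ((n ^ 2 + 1) * ((2 ^ k + 1) * Real.exp (-(n / k))))) := by
  have hL := hk.le_log
  have hkL := hk.log_le
  have hk0 := hk.pos
  have hd1 := hk.degree_bound hd
  have hd0 : 0 < d := lt_of_lt_of_le (by positivity) hd1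
  have hk2 : k * (k + 1) ≤ n := by nlinarith
  have hn2 : 2 ≤ n := by nlinarith
  have hkr : (0 : ℝ) < k := by positivity
  have hnr : (0 : ℝ) < n := by positivity
  have hmom := choose_card_bichrom_mul_le hn2 hk0 hd0 hd (by nlinarith) (by linarith) σ
  set F := ((bichrom σ).powersetCard ⌈d * n / 2⌉₊).filter
    (fun E => ¬ HasTypicalWhitening E σ) with hF
  by_cases hb : IsBalanced σ
  · have h1 : (#F : ℝ) ≤ (#(bichrom σ)).choose ⌈d * n / 2⌉₊ *
        ((n ^ 2 + 1) * ((2 ^ k + 1) * Real.exp (-(4 * (n / k))))) := by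
      refine le_trans (Nat.cast_le.2 (card_le_card fun E hE => ?_))
        (card_filter_isAtypical_le hb hk hn hf hd1 hd')
      rw [hF, mem_filter] at hE
      rw [mem_filter]
      refine ⟨hE.1, ?_⟩
      by_contra h
      exact hE.2 (hasTypicalWhitening_of_not_isAtypical hk hk2 hb h)
    have h2 : Real.exp (3 * n / k - k * Real.log k * imbalance σ / (2 * n)) ≤
        Real.exp (3 * (n / k)) := by
      rw [Real.exp_le_exp]
      have : 0 ≤ k * Real.log k * imbalance σ / (2 * n) := by
        have := imbalance_nonneg σ
        positivity
      have h3 : (3 : ℝ) * n / k = 3 * (n / k) := by ring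
      linarith
    calc (#F : ℝ) * (k : ℝ) ^ n ≤ ((#(bichrom σ)).choose ⌈d * n / 2⌉₊ *
          ((n ^ 2 + 1) * ((2 ^ k + 1) * Real.exp (-(4 * (n / k)))))) * (k : ℝ) ^ n :=
          mul_le_mul_of_nonneg_right h1 (by positivity)
      _ = ((#(bichrom σ)).choose ⌈d * n / 2⌉₊ * (k : ℝ) ^ n) *
          ((n ^ 2 + 1) * ((2 ^ k + 1) * Real.exp (-(4 * (n / k))))) := by ring
      _ ≤ ((#(allPairs n)).choose ⌈d * n / 2⌉₊ *
          (Real.exp (d + 1) * Real.exp (3 * (n / k)))) *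
          ((n ^ 2 + 1) * ((2 ^ k + 1) * Real.exp (-(4 * (n / k))))) := by
          refine mul_le_mul_of_nonneg_right (hmom.trans ?_) (by positivity)
          gcongr
      _ = (#(allPairs n)).choose ⌈d * n / 2⌉₊ * (Real.exp (d + 1) * ((n ^ 2 + 1) *
          ((2 ^ k + 1) * (Real.exp (3 * (n / k)) * Real.exp (-(4 * (n / k))))))) := by ring
      _ = _ := by
          rw [← Real.exp_add]
          congr 6
          ring
  · have h1 : (#F : ℝ) ≤ (#(bichrom σ)).choose ⌈d * n / 2⌉₊ := by
      rw [← card_powersetCard]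
      exact Nat.cast_le.2 (card_le_card (filter_subset _ _))
    have h2 : 3 * n / k - k * Real.log k * imbalance σ / (2 * n) ≤ -(n / k : ℝ) := by
      have h3 : k * Real.log k * (8 * (n / k : ℝ) ^ 2 / Real.log k) / (2 * n) ≤
          k * Real.log k * imbalance σ / (2 * n) := by
        have := (not_le.1 hb).le
        gcongr
      have h4 : k * Real.log k * (8 * (n / k : ℝ) ^ 2 / Real.log k) / (2 * n) =
          4 * (n / k) := by
        have : Real.log k ≠ 0 := by linarith
        field_simp
        norm_num
      have h5 : (3 : ℝ) * n / k = 3 * (n / k) := by ring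
      linarith
    refine (mul_le_mul_of_nonneg_right h1 (by positivity)).trans (hmom.trans ?_)
    have h6 : Real.exp (3 * n / k - k * Real.log k * imbalance σ / (2 * n)) ≤
        (n ^ 2 + 1) * ((2 ^ k + 1) * Real.exp (-(n / k))) := by
      refine (Real.exp_le_exp.2 h2).trans ?_
      rw [← mul_assoc]
      refine le_mul_of_one_le_left (Real.exp_nonneg _) ?_
      have : (0 : ℝ) ≤ 2 ^ k := by positivity
      nlinarith [sq_nonneg (n : ℝ)]
    gcongr

theorem natCard_graphSpace_subtype {m : ℕ} (P : Finset (Sym2 (Fin n)) → Prop) :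
    Nat.card {G : GraphSpace n m // P G.1} = #(((allPairs n).powersetCard m).filter P) := by
  have hmem : ∀ E : Finset (Sym2 (Fin n)), E ∈ (allPairs n).powersetCard m ↔
      #E = m ∧ ∀ e ∈ E, ¬ e.IsDiag := by
    intro E
    rw [mem_powersetCard, and_comm, allPairs]
    simp [subset_iff]
  rw [← Nat.card_eq_finsetCard]
  exact Nat.card_congr
    { toFun := fun G => ⟨G.1.1, mem_filter.2 ⟨(hmem _).2 G.1.2, G.2⟩⟩
      invFun := fun E => ⟨⟨E.1, (hmem _).1 (mem_filter.1 E.2).1⟩, (mem_filter.1 E.2).2⟩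
      left_inv := fun _ => rfl
      right_inv := fun _ => rfl }

theorem subset_bichrom_of_isColoring {E : Finset (Sym2 (Fin n))} {σ : Fin n → Fin k}
    (h : IsColoring E σ) : E ⊆ bichrom σ := by
  intro e he
  induction e with
  | h u v => exact mk_mem_bichrom.2 (h u v he)

/-- Every `k`-coloring of the graph `E` has a typical whitening. -/
def AllTypical (k : ℕ) (E : Finset (Sym2 (Fin n))) : Prop :=
  ∀ σ : Fin n → Fin k, IsColoring E σ → HasTypicalWhitening E σ

theorem card_filter_exists_coloring_le (hk : IsLarge k) {d : ℝ}
    (hd : 2 * k * Real.log k - Real.log k - 4 ≤ d) (hd' : d ≤ 2 * k * Real.log k)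
    (hn : 4 * k ^ 2 ≤ n) (hf : 1000 ≤ fluctuation n k) :
    (#(((allPairs n).powersetCard ⌈d * n / 2⌉₊).filter
      (fun E => ¬ AllTypical k E)) : ℝ) ≤
      (#(allPairs n)).choose ⌈d * n / 2⌉₊ *
        (Real.exp (d + 1) * ((n ^ 2 + 1) * ((2 ^ k + 1) * Real.exp (-(n / k))))) := by
  have hk0 : (0 : ℝ) < k := Nat.cast_pos.2 hk.pos
  have hsub : ((allPairs n).powersetCard ⌈d * n / 2⌉₊).filter
      (fun E => ¬ AllTypical k E) ⊆
      (univ : Finset (Fin n → Fin k)).biUnion fun σ =>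
        ((bichrom σ).powersetCard ⌈d * n / 2⌉₊).filter
          (fun E => ¬ HasTypicalWhitening E σ) := by
    intro E hE
    obtain ⟨hE1, hE2⟩ := mem_filter.1 hE
    unfold AllTypical at hE2
    push Not at hE2
    obtain ⟨σ, hσ, ht⟩ := hE2
    exact mem_biUnion.2 ⟨σ, mem_univ _, mem_filter.2 ⟨mem_powersetCard.2
      ⟨subset_bichrom_of_isColoring hσ, (mem_powersetCard.1 hE1).2⟩, ht⟩⟩
  have h1 := Nat.cast_le (α := ℝ).2 ((card_le_card hsub).trans card_biUnion_le)
  refine h1.trans ?_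
  rw [Nat.cast_sum]
  refine (sum_le_card_nsmul _ _ _ fun σ _ => (le_div_iff₀ (by positivity)).2
    (card_filter_not_hasTypicalWhitening_mul_le hk hd hd' hn hf σ)).trans_eq ?_
  rw [card_univ, Fintype.card_fun, Fintype.card_fin, Fintype.card_fin, nsmul_eq_mul,
    Nat.cast_pow, mul_div_cancel₀ _ (by positivity)]

theorem prob_forall_coloring_ge (hk : IsLarge k) {d : ℝ}
    (hd : 2 * k * Real.log k - Real.log k - 4 ≤ d) (hd' : d ≤ 2 * k * Real.log k)
    (hn : 4 * k ^ 2 ≤ n) (hf : 1000 ≤ fluctuation n k) :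
    1 - Real.exp (d + 1) * ((n ^ 2 + 1) * ((2 ^ k + 1) * Real.exp (-(n / k)))) ≤
      prob (fun G : GraphSpace n ⌈d * n / 2⌉₊ => AllTypical k G.1) := by
  have hk0 := hk.pos
  have hkL := hk.log_le
  have hcard : Nat.card (GraphSpace n ⌈d * n / 2⌉₊) =
      (#(allPairs n)).choose ⌈d * n / 2⌉₊ := by
    have h := natCard_graphSpace_subtype (n := n) (m := ⌈d * n / 2⌉₊) (fun _ => True)
    rw [filter_true, card_powersetCard] at h
    rw [← h]
    exact Nat.card_congr (Equiv.subtypeUnivEquiv fun _ => trivial).symm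
  have hm : ⌈d * n / 2⌉₊ ≤ #(allPairs n) := by
    rw [Nat.ceil_le, card_allPairs, Nat.cast_choose_two]
    have hn' : 4 * (k : ℝ) ^ 2 ≤ n := by exact_mod_cast hn
    have hk1 : (1 : ℝ) ≤ k := by exact_mod_cast hk0
    have h1 : d ≤ n - 1 := by nlinarith
    have := mul_le_mul_of_nonneg_right h1 (Nat.cast_nonneg (α := ℝ) n)
    linarith
  have hpos : (0 : ℝ) < (#(allPairs n)).choose ⌈d * n / 2⌉₊ :=
    Nat.cast_pos.2 (Nat.choose_pos hm)
  rw [prob, hcard, natCard_graphSpace_subtype, le_div_iff₀ hpos]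
  have h1 := card_filter_exists_coloring_le hk hd hd' hn hf
  have h2 := card_filter_add_card_filter_not (s := (allPairs n).powersetCard ⌈d * n / 2⌉₊)
    (fun E => AllTypical k E)
  rw [card_powersetCard] at h2
  have h3 : ((#(((allPairs n).powersetCard ⌈d * n / 2⌉₊).filter (fun E => AllTypical k E)) : ℝ)) +
      #(((allPairs n).powersetCard ⌈d * n / 2⌉₊).filter (fun E => ¬ AllTypical k E)) =
      (#(allPairs n)).choose ⌈d * n / 2⌉₊ := by exact_mod_cast h2
  linarith

theorem prob_le_one {Ω : Type*} [Finite Ω] (p : Ω → Prop) : prob p ≤ 1 :=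
  div_le_one_of_le₀ (Nat.cast_le.2 (Finite.card_subtype_le p)) (Nat.cast_nonneg _)

instance {m : ℕ} : Finite (GraphSpace n m) :=
  inferInstanceAs (Finite {E : Finset (Sym2 (Fin n)) // E.card = m ∧ ∀ e ∈ E, ¬ e.IsDiag})

theorem tendsto_failure_bound (hk : 0 < k) (c c' : ℝ) :
    Tendsto (fun n : ℕ => 1 - c * (((n : ℝ) ^ 2 + 1) * (c' * Real.exp (-(n / k)))))
      atTop (nhds 1) := by
  have hk' : (0 : ℝ) < k := Nat.cast_pos.2 hk
  have hu : Tendsto (fun n : ℕ => (n : ℝ) / k) atTop atTop :=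
    tendsto_natCast_atTop_atTop.atTop_div_const hk'
  have h2 := (Real.tendsto_pow_mul_exp_neg_atTop_nhds_zero 2).comp hu
  have h0 := (Real.tendsto_pow_mul_exp_neg_atTop_nhds_zero 0).comp hu
  have h := ((h2.const_mul ((k : ℝ) ^ 2)).add h0).const_mul (c * c')
  rw [mul_zero, add_zero, mul_zero] at h
  have h' := h.const_sub 1
  rw [sub_zero] at h'
  refine h'.congr fun n => ?_
  simp only [Function.comp, pow_zero, one_mul]
  field_simp

theorem tendsto_prob_forall_coloring (hk : IsLarge k) {d : ℝ}
    (hd : 2 * k * Real.log k - Real.log k - 4 ≤ d) (hd' : d ≤ 2 * k * Real.log k) :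
    Tendsto (fun n : ℕ => prob (fun G : GraphSpace n ⌈d * n / 2⌉₊ => AllTypical k G.1))
      atTop (nhds 1) := by
  have hk' : (0 : ℝ) < k := Nat.cast_pos.2 hk.pos
  have hsq := hk.le_sqrt
  have hf : Tendsto (fun n : ℕ => fluctuation n k) atTop atTop :=
    (tendsto_natCast_atTop_atTop.atTop_div_const hk').const_mul_atTop (by positivity)
  refine tendsto_of_tendsto_of_tendsto_of_le_of_le'
    (tendsto_failure_bound hk.pos (Real.exp (d + 1)) (2 ^ k + 1)) tendsto_const_nhds ?_
    (Eventually.of_forall fun n => prob_le_one _)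
  filter_upwards [eventually_ge_atTop (4 * k ^ 2), hf.eventually_ge_atTop 1000] with n hn hfn
  exact prob_forall_coloring_ge hk hd hd' hn hfn

end

theorem statement6 :
    ∃ (k₀ : ℕ) (ε : ℕ → ℝ), (∀ k, 0 < ε k) ∧ Tendsto ε atTop (nhds 0) ∧
      ∀ k : ℕ, k₀ ≤ k → ∀ d : ℝ,
        2 * k * Real.log k - Real.log k - 4 ≤ d → d ≤ 2 * k * Real.log k →
        Tendsto (fun n : ℕ =>
            prob (fun G : GraphSpace n ⌈d * n / 2⌉₊ =>
              ∀ σ : Fin n → Fin k, IsColoring G.1 σ →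
                -- (1): `|σ̂⁻¹(0)| ≤ n·k^(−2/3)`
                ((Nat.card {v : Fin n // v ∉ whiteSet G.1 σ} : ℝ) ≤
                    n * (k : ℝ) ^ (-(2 : ℝ) / 3)) ∧
                -- (2): `| |σ̂⁻¹(i)| − n/k | ≤ ε k · n/k` for all colors `i`
                (∀ i : Fin k,
                  |(Nat.card {v : Fin n // v ∈ whiteSet G.1 σ ∧ σ v = i} : ℝ) - n / k| ≤
                    ε k * n / k) ∧
                -- (3): at most `(ln k)^9` colors deviate by more than `n/(k (ln k)^3)`
                ((Nat.card {i : Fin k //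
                    n / (k * Real.log k ^ (3 : ℕ)) <
                      |(Nat.card {v : Fin n // v ∈ whiteSet G.1 σ ∧ σ v = i} : ℝ) - n / k|} : ℝ)
                  ≤ Real.log k ^ (9 : ℕ))))
          atTop (nhds 1) := by
  obtain ⟨k₀, hk₀⟩ := eventually_atTop.1 eventually_isLarge
  exact ⟨k₀, whiteningError, whiteningError_pos, tendsto_whiteningError,
    fun k hk d hd hd' => tendsto_prob_forall_coloring (hk₀ k hk) hd hd'⟩
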